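/- arXiv:1706.07356 — 6 statements merged into one kernel-verified Lean document; each statement's English description precedes it below -/
import Mathlib

section
/- For every α ∈ (0,1) ∩ ℚ, every h ∈ ℝ³ and every J ∈ ℝ^{3×3}, the limit as N → ∞ (along integers N with αN ∈ ℕ) of (1/N)·log Z_N(h,J,α) exists and equals max_{d ∈ Ω_α} ψ(d;h,J,α). -/
noncomputable section
open Real Matrix Filter Topology

/-- γ(x) = exp(x log x − x); note Real.log 0 = 0 gives γ(0) = 1. -/
def mdGamma (x : ℝ) : ℝ := Real.exp (x * Real.log x - x)

/-- The constraint set Ω_α. -/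
def mdOmega (α : ℝ) : Set (Fin 3 → ℝ) :=
  {d | (∀ i, 0 ≤ d i) ∧ 2 * d 0 + d 2 ≤ α ∧ 2 * d 1 + d 2 ≤ 1 - α}

/-- Entropy density s(d; α). -/
def mdEntropy (α : ℝ) (d : Fin 3 → ℝ) : ℝ :=
  Real.log (mdGamma α) + Real.log (mdGamma (1 - α))
    - Real.log (mdGamma (α - 2 * d 0 - d 2))
    - Real.log (mdGamma (1 - α - 2 * d 1 - d 2))
    - Real.log (mdGamma (d 0)) - Real.log (mdGamma (d 1)) - Real.log (mdGamma (d 2))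
    - d 0 * Real.log 2 - d 1 * Real.log 2

/-- Energy density ε(d; h, J). -/
def mdEnergy (h : Fin 3 → ℝ) (J : Matrix (Fin 3) (Fin 3) ℝ) (d : Fin 3 → ℝ) : ℝ :=
  - (h ⬝ᵥ d) - (1 / 2) * (J.mulVec d ⬝ᵥ d)

/-- Variational pressure ψ(d; h, J, α). -/
def mdPsi (h : Fin 3 → ℝ) (J : Matrix (Fin 3) (Fin 3) ℝ) (α : ℝ) (d : Fin 3 → ℝ) : ℝ :=
  mdEntropy α d - mdEnergy h J d

/-- A monomer-dimer configuration: a set of non-degenerate pairwise disjoint edges. -/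
def IsMDConfig (N : ℕ) (Δ : Finset (Sym2 (Fin N))) : Prop :=
  (∀ e ∈ Δ, ¬ e.IsDiag) ∧
    ∀ e ∈ Δ, ∀ e' ∈ Δ, e ≠ e' → ∀ v : Fin N, v ∈ e → v ∉ e'

open scoped Classical in
/-- All monomer-dimer configurations on `N` sites. -/
def mdConfigs (N : ℕ) : Finset (Finset (Sym2 (Fin N))) :=
  Finset.univ.filter fun Δ => IsMDConfig N Δ

open scoped Classical in
/-- Number of dimers internal to population A (sites with index < N_A). -/
def countA (N NA : ℕ) (Δ : Finset (Sym2 (Fin N))) : ℕ :=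
  (Δ.filter fun e => ∀ v : Fin N, v ∈ e → (v : ℕ) < NA).card

open scoped Classical in
/-- Number of dimers internal to population B (sites with index ≥ N_A). -/
def countB (N NA : ℕ) (Δ : Finset (Sym2 (Fin N))) : ℕ :=
  (Δ.filter fun e => ∀ v : Fin N, v ∈ e → NA ≤ (v : ℕ)).card

open scoped Classical in
/-- Number of mixed dimers. -/
def countAB (N NA : ℕ) (Δ : Finset (Sym2 (Fin N))) : ℕ :=
  (Δ.filter fun e => (∃ v : Fin N, v ∈ e ∧ (v : ℕ) < NA) ∧ ∃ v : Fin N, v ∈ e ∧ NA ≤ (v : ℕ)).card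

/-- The dimer numbers of a configuration, as a vector in ℝ³. -/
def dimerVec (N NA : ℕ) (Δ : Finset (Sym2 (Fin N))) : Fin 3 → ℝ :=
  ![ (countA N NA Δ : ℝ), (countB N NA Δ : ℝ), (countAB N NA Δ : ℝ)]

/-- Hamiltonian H_N(D) = −h·D − (1/(2N)) (JD)·D. -/
def mdHamiltonian (N : ℕ) (h : Fin 3 → ℝ) (J : Matrix (Fin 3) (Fin 3) ℝ)
    (D : Fin 3 → ℝ) : ℝ :=
  - (h ⬝ᵥ D) - (1 / (2 * N)) * (J.mulVec D ⬝ᵥ D)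

/-- Partition function Z_N(h, J, α) with N_A = NA. -/
def mdZ (N NA : ℕ) (h : Fin 3 → ℝ) (J : Matrix (Fin 3) (Fin 3) ℝ) : ℝ :=
  ∑ Δ ∈ mdConfigs N,
    ((N : ℝ) ^ (countA N NA Δ + countB N NA Δ + countAB N NA Δ))⁻¹ *
      Real.exp (- mdHamiltonian N h J (dimerVec N NA Δ))


/-! ### Combinatorics -/

section Comb
open scoped Classical
open Finset

lemma md_double_count {E : Type*} [Fintype E] [DecidableEq E] (P : E → Prop)
    (S S' : Finset (Finset E)) (k m : ℕ)
    (h1 : ∀ Δ ∈ S, (univ.filter fun e => e ∉ Δ ∧ P e ∧ insert e Δ ∈ S').card = m)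
    (h2 : ∀ Δ ∈ S', (Δ.filter fun e => P e ∧ Δ.erase e ∈ S).card = k) :
    S.card * m = S'.card * k := by
  have e1 : (S.sigma fun Δ => univ.filter fun e => e ∉ Δ ∧ P e ∧ insert e Δ ∈ S').card
      = S.card * m := by
    rw [card_sigma, sum_congr rfl h1, sum_const, smul_eq_mul]
  have e2 : (S'.sigma fun Δ => Δ.filter fun e => P e ∧ Δ.erase e ∈ S).card
      = S'.card * k := by
    rw [card_sigma, sum_congr rfl h2, sum_const, smul_eq_mul]
  rw [← e1, ← e2]
  refine card_bij' (fun x _ => ⟨insert x.2 x.1, x.2⟩) (fun x _ => ⟨x.1.erase x.2, x.2⟩) ?_ ?_ ?_ ?_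
  · rintro ⟨Δ, e⟩ hx
    simp only [mem_sigma, mem_filter, mem_univ, true_and] at hx ⊢
    obtain ⟨hS, he, hP, hS'⟩ := hx
    refine ⟨hS', mem_insert_self _ _, hP, ?_⟩
    rwa [erase_insert he]
  · rintro ⟨Δ, e⟩ hx
    simp only [mem_sigma, mem_filter, mem_univ, true_and] at hx ⊢
    obtain ⟨hS', he, hP, hS⟩ := hx
    refine ⟨hS, notMem_erase _ _, hP, ?_⟩
    rwa [insert_erase he]
  · rintro ⟨Δ, e⟩ hx
    simp only [mem_sigma, mem_filter, mem_univ, true_and] at hx ⊢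
    rw [erase_insert hx.2.1]
  · rintro ⟨Δ, e⟩ hx
    simp only [mem_sigma, mem_filter, mem_univ, true_and] at hx ⊢
    rw [insert_erase hx.2.1]

variable {N NA : ℕ}

def pA (N NA : ℕ) (e : Sym2 (Fin N)) : Prop := ∀ v : Fin N, v ∈ e → (v : ℕ) < NA
def pB (N NA : ℕ) (e : Sym2 (Fin N)) : Prop := ∀ v : Fin N, v ∈ e → NA ≤ (v : ℕ)
def pAB (N NA : ℕ) (e : Sym2 (Fin N)) : Prop :=
  (∃ v : Fin N, v ∈ e ∧ (v : ℕ) < NA) ∧ ∃ v : Fin N, v ∈ e ∧ NA ≤ (v : ℕ)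

lemma pA_mk (u v : Fin N) : pA N NA s(u, v) ↔ (u : ℕ) < NA ∧ (v : ℕ) < NA := by
  simp [pA, Sym2.mem_iff]
lemma pB_mk (u v : Fin N) : pB N NA s(u, v) ↔ NA ≤ (u : ℕ) ∧ NA ≤ (v : ℕ) := by
  simp [pB, Sym2.mem_iff]
lemma pAB_mk (u v : Fin N) : pAB N NA s(u, v) ↔
    ((u : ℕ) < NA ∨ (v : ℕ) < NA) ∧ (NA ≤ (u : ℕ) ∨ NA ≤ (v : ℕ)) := by
  simp [pAB, Sym2.mem_iff]

lemma countA_eq (Δ : Finset (Sym2 (Fin N))) : countA N NA Δ = (Δ.filter (pA N NA)).card := by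
  unfold countA pA; congr
lemma countB_eq (Δ : Finset (Sym2 (Fin N))) : countB N NA Δ = (Δ.filter (pB N NA)).card := by
  unfold countB pB; congr
lemma countAB_eq (Δ : Finset (Sym2 (Fin N))) : countAB N NA Δ = (Δ.filter (pAB N NA)).card := by
  unfold countAB pAB; congr

lemma md_filter_insert {E : Type*} [DecidableEq E] (p : E → Prop) [DecidablePred p] (Δ : Finset E) (e : E) (he : e ∉ Δ) :
    ((insert e Δ).filter p).card = (Δ.filter p).card + if p e then 1 else 0 := by
  rw [filter_insert]
  split_ifs with hp
  · rw [card_insert_of_notMem]; simp [he]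
  · simp

def mdFree (Δ : Finset (Sym2 (Fin N))) : Finset (Fin N) :=
  univ.filter fun v => ∀ e ∈ Δ, v ∉ e

def mdFreeA (NA : ℕ) (Δ : Finset (Sym2 (Fin N))) : Finset (Fin N) :=
  (mdFree Δ).filter fun v => (v : ℕ) < NA
def mdFreeB (NA : ℕ) (Δ : Finset (Sym2 (Fin N))) : Finset (Fin N) :=
  (mdFree Δ).filter fun v => NA ≤ (v : ℕ)

lemma mem_mdFreeA {Δ : Finset (Sym2 (Fin N))} {v : Fin N} :
    v ∈ mdFreeA NA Δ ↔ (∀ e ∈ Δ, v ∉ e) ∧ (v : ℕ) < NA := by simp [mdFreeA, mdFree]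
lemma mem_mdFreeB {Δ : Finset (Sym2 (Fin N))} {v : Fin N} :
    v ∈ mdFreeB NA Δ ↔ (∀ e ∈ Δ, v ∉ e) ∧ NA ≤ (v : ℕ) := by simp [mdFreeB, mdFree]

lemma isMD_insert {Δ : Finset (Sym2 (Fin N))} {u v : Fin N} (he : s(u, v) ∉ Δ) :
    IsMDConfig N (insert s(u, v) Δ) ↔
      IsMDConfig N Δ ∧ u ≠ v ∧ (∀ e ∈ Δ, u ∉ e) ∧ (∀ e ∈ Δ, v ∉ e) := by
  constructor
  · rintro ⟨h1, h2⟩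
    refine ⟨⟨fun e h => h1 e (mem_insert_of_mem h), fun e h e' h' =>
      h2 e (mem_insert_of_mem h) e' (mem_insert_of_mem h')⟩, ?_, ?_, ?_⟩
    · simpa using h1 _ (mem_insert_self _ _)
    · intro e h
      exact h2 _ (mem_insert_self _ _) e (mem_insert_of_mem h) (by rintro rfl; exact he h) u (by simp)
    · intro e h
      exact h2 _ (mem_insert_self _ _) e (mem_insert_of_mem h) (by rintro rfl; exact he h) v (by simp)
  · rintro ⟨⟨h1, h2⟩, huv, hu, hv⟩
    refine ⟨?_, ?_⟩
    · intro e h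
      rcases mem_insert.1 h with rfl | h
      · simpa using huv
      · exact h1 e h
    · intro e k e' k' hne w hw hw'
      rcases mem_insert.1 k with rfl | h
      · rcases mem_insert.1 k' with rfl | h'
        · exact hne rfl
        · rcases Sym2.mem_iff.1 hw with rfl | rfl
          · exact hu _ h' hw'
          · exact hv _ h' hw'
      · rcases mem_insert.1 k' with rfl | h'
        · rcases Sym2.mem_iff.1 hw' with rfl | rfl
          · exact hu _ h hw
          · exact hv _ h hw
        · exact h2 e h e' h' hne w hw hw'

lemma isMD_mono {Δ Δ' : Finset (Sym2 (Fin N))} (h : Δ ⊆ Δ') (hc : IsMDConfig N Δ') :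
    IsMDConfig N Δ :=
  ⟨fun e he => hc.1 e (h he), fun e he e' he' => hc.2 e (h he) e' (h he')⟩

lemma md_free_filter (p : Fin N → Prop) [DecidablePred p] {Δ : Finset (Sym2 (Fin N))} {u v : Fin N}
    (huv : u ≠ v) (hu : ∀ e ∈ Δ, u ∉ e) (hv : ∀ e ∈ Δ, v ∉ e) :
    ((mdFree (insert s(u, v) Δ)).filter p).card + (if p u then 1 else 0) + (if p v then 1 else 0)
      = ((mdFree Δ).filter p).card := by
  have : mdFree Δ = insert u (insert v (mdFree (insert s(u, v) Δ))) := by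
    ext w
    simp only [mdFree, mem_filter, mem_univ, true_and, mem_insert, forall_eq_or_imp, Sym2.mem_iff,
      not_or]
    constructor
    · intro hw
      by_cases h1 : w = u
      · exact Or.inl h1
      by_cases h2 : w = v
      · exact Or.inr (Or.inl h2)
      exact Or.inr (Or.inr ⟨⟨h1, h2⟩, hw⟩)
    · rintro (rfl | rfl | ⟨_, hw⟩)
      · exact hu
      · exact hv
      · exact hw
  rw [this, md_filter_insert, md_filter_insert]
  · ring
  · simp [mdFree]
  · simp [mdFree, huv]

lemma md_freeA_card (hN : NA ≤ N) (Δ : Finset (Sym2 (Fin N))) (hΔ : IsMDConfig N Δ) :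
    (mdFreeA NA Δ).card + 2 * countA N NA Δ + countAB N NA Δ = NA := by
  induction Δ using Finset.induction_on with
  | empty =>
    simp only [mdFreeA, mdFree, countA, countAB]
    simp [Fin.card_filter_val_lt, hN]
  | insert e Δ he ih =>
    induction e using Sym2.ind with
    | _ u v =>
    obtain ⟨hc, huv, hu, hv⟩ := (isMD_insert he).1 hΔ
    have := ih hc
    have h3 := md_free_filter (fun v : Fin N => (v : ℕ) < NA) huv hu hv
    rw [countA_eq, countAB_eq] at this ⊢
    rw [md_filter_insert _ _ _ he, md_filter_insert _ _ _ he]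
    simp only [pA_mk, pAB_mk]
    unfold mdFreeA at this ⊢
    split_ifs at h3 ⊢ <;> omega

lemma md_freeB_card (hN : NA ≤ N) (Δ : Finset (Sym2 (Fin N))) (hΔ : IsMDConfig N Δ) :
    (mdFreeB NA Δ).card + 2 * countB N NA Δ + countAB N NA Δ = N - NA := by
  induction Δ using Finset.induction_on with
  | empty =>
    simp only [mdFreeB, mdFree, countB, countAB]
    have := Finset.card_filter_add_card_filter_not (s := (univ : Finset (Fin N))) (fun v => (v : ℕ) < NA)
    simp [Fin.card_filter_val_lt, hN] at this ⊢
    omega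
  | insert e Δ he ih =>
    induction e using Sym2.ind with
    | _ u v =>
    obtain ⟨hc, huv, hu, hv⟩ := (isMD_insert he).1 hΔ
    have := ih hc
    have h3 := md_free_filter (fun v : Fin N => NA ≤ (v : ℕ)) huv hu hv
    rw [countB_eq, countAB_eq] at this ⊢
    rw [md_filter_insert _ _ _ he, md_filter_insert _ _ _ he]
    simp only [pB_mk, pAB_mk]
    unfold mdFreeB at this ⊢
    split_ifs at h3 ⊢ <;> omega

def mdFib (N NA a b c : ℕ) : Finset (Finset (Sym2 (Fin N))) :=
  (mdConfigs N).filter fun Δ => countA N NA Δ = a ∧ countB N NA Δ = b ∧ countAB N NA Δ = c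

lemma mem_mdFib {a b c : ℕ} {Δ : Finset (Sym2 (Fin N))} : Δ ∈ mdFib N NA a b c ↔
    IsMDConfig N Δ ∧ countA N NA Δ = a ∧ countB N NA Δ = b ∧ countAB N NA Δ = c := by
  simp [mdFib, mdConfigs]

lemma md_counts_insert {Δ : Finset (Sym2 (Fin N))} {e : Sym2 (Fin N)} (he : e ∉ Δ) :
    countA N NA (insert e Δ) = countA N NA Δ + (if pA N NA e then 1 else 0) ∧
    countB N NA (insert e Δ) = countB N NA Δ + (if pB N NA e then 1 else 0) ∧
    countAB N NA (insert e Δ) = countAB N NA Δ + (if pAB N NA e then 1 else 0) := by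
  simp only [countA_eq, countB_eq, countAB_eq]
  exact ⟨md_filter_insert _ _ _ he, md_filter_insert _ _ _ he, md_filter_insert _ _ _ he⟩

lemma pA_excl {e : Sym2 (Fin N)} (h : pA N NA e) : ¬ pB N NA e ∧ ¬ pAB N NA e := by
  induction e using Sym2.ind with
  | _ u v => simp only [pA_mk, pB_mk, pAB_mk] at *; omega
lemma pB_excl {e : Sym2 (Fin N)} (h : pB N NA e) : ¬ pA N NA e ∧ ¬ pAB N NA e := by
  induction e using Sym2.ind with
  | _ u v => simp only [pA_mk, pB_mk, pAB_mk] at *; omega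
lemma pAB_excl {e : Sym2 (Fin N)} (h : pAB N NA e) : ¬ pA N NA e ∧ ¬ pB N NA e := by
  induction e using Sym2.ind with
  | _ u v => simp only [pA_mk, pB_mk, pAB_mk] at *; omega

lemma md_notMem {Δ : Finset (Sym2 (Fin N))} {u v : Fin N} (hu : ∀ e ∈ Δ, u ∉ e) : s(u, v) ∉ Δ :=
  fun h => hu _ h (by simp)

lemma mdFib_recA (hN : NA ≤ N) (a b c x : ℕ) (hx : 2 * a + c + x = NA) :
    (mdFib N NA a b c).card * x.choose 2 = (mdFib N NA (a + 1) b c).card * (a + 1) := by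
  apply md_double_count (pA N NA)
  · intro Δ hΔ
    rw [mem_mdFib] at hΔ
    have hf := md_freeA_card hN Δ hΔ.1
    have hx' : (mdFreeA NA Δ).card = x := by omega
    rw [← hx', ← Sym2.card_image_offDiag]
    congr 1
    ext e
    induction e using Sym2.ind with
    | _ u v =>
    simp only [mem_filter, mem_univ, true_and, mem_image, mem_offDiag, Prod.exists, mem_mdFreeA]
    constructor
    · rintro ⟨he, hp, hi⟩
      rw [mem_mdFib, isMD_insert he] at hi
      rw [pA_mk] at hp
      exact ⟨u, v, ⟨⟨hi.1.2.2.1, hp.1⟩, ⟨hi.1.2.2.2, hp.2⟩, hi.1.2.1⟩, rfl⟩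
    · rintro ⟨u', v', ⟨⟨hu, hu1⟩, ⟨hv, hv1⟩, hne⟩, heq⟩
      have heq : s(u', v') = s(u, v) := heq
      rw [← heq]
      have he := md_notMem (v := v') hu
      have hp : pA N NA s(u', v') := (pA_mk _ _).2 ⟨hu1, hv1⟩
      refine ⟨he, hp, ?_⟩
      obtain ⟨c1, c2, c3⟩ := md_counts_insert (NA := NA) he
      rw [mem_mdFib, isMD_insert he, c1, c2, c3]
      have := pA_excl hp
      simp [hp, this, hΔ, hne]
      exact ⟨hu, hv⟩
  · intro Δ hΔ
    rw [mem_mdFib] at hΔ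
    rw [← hΔ.2.1, countA_eq]
    congr 1
    ext e
    rw [mem_filter, mem_filter]
    refine and_congr_right fun he => ?_
    refine ⟨fun h => h.1, fun hp => ⟨hp, ?_⟩⟩
    obtain ⟨c1, c2, c3⟩ := md_counts_insert (NA := NA) (notMem_erase e Δ)
    rw [insert_erase he] at c1 c2 c3
    have := pA_excl hp
    simp [hp, this, hΔ] at c1 c2 c3
    rw [mem_mdFib]
    exact ⟨isMD_mono (erase_subset _ _) hΔ.1, c1.symm, c2.symm, c3.symm⟩

lemma mdFib_recB (hN : NA ≤ N) (a b c x : ℕ) (hx : 2 * b + c + x = N - NA) :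
    (mdFib N NA a b c).card * x.choose 2 = (mdFib N NA a (b + 1) c).card * (b + 1) := by
  apply md_double_count (pB N NA)
  · intro Δ hΔ
    rw [mem_mdFib] at hΔ
    have hf := md_freeB_card hN Δ hΔ.1
    have hx' : (mdFreeB NA Δ).card = x := by omega
    rw [← hx', ← Sym2.card_image_offDiag]
    congr 1
    ext e
    induction e using Sym2.ind with
    | _ u v =>
    simp only [mem_filter, mem_univ, true_and, mem_image, mem_offDiag, Prod.exists, mem_mdFreeB]
    constructor
    · rintro ⟨he, hp, hi⟩
      rw [mem_mdFib, isMD_insert he] at hi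
      rw [pB_mk] at hp
      exact ⟨u, v, ⟨⟨hi.1.2.2.1, hp.1⟩, ⟨hi.1.2.2.2, hp.2⟩, hi.1.2.1⟩, rfl⟩
    · rintro ⟨u', v', ⟨⟨hu, hu1⟩, ⟨hv, hv1⟩, hne⟩, heq⟩
      have heq : s(u', v') = s(u, v) := heq
      rw [← heq]
      have he := md_notMem (v := v') hu
      have hp : pB N NA s(u', v') := (pB_mk _ _).2 ⟨hu1, hv1⟩
      refine ⟨he, hp, ?_⟩
      obtain ⟨c1, c2, c3⟩ := md_counts_insert (NA := NA) he
      rw [mem_mdFib, isMD_insert he, c1, c2, c3]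
      have := pB_excl hp
      simp [hp, this, hΔ, hne]
      exact ⟨hu, hv⟩
  · intro Δ hΔ
    rw [mem_mdFib] at hΔ
    rw [← hΔ.2.2.1, countB_eq]
    congr 1
    ext e
    rw [mem_filter, mem_filter]
    refine and_congr_right fun he => ?_
    refine ⟨fun h => h.1, fun hp => ⟨hp, ?_⟩⟩
    obtain ⟨c1, c2, c3⟩ := md_counts_insert (NA := NA) (notMem_erase e Δ)
    rw [insert_erase he] at c1 c2 c3
    have := pB_excl hp
    simp [hp, this, hΔ] at c1 c2 c3
    rw [mem_mdFib]
    exact ⟨isMD_mono (erase_subset _ _) hΔ.1, c1.symm, c2.symm, c3.symm⟩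

lemma mdFib_recAB (hN : NA ≤ N) (a b c x y : ℕ) (hx : 2 * a + c + x = NA)
    (hy : 2 * b + c + y = N - NA) :
    (mdFib N NA a b c).card * (x * y) = (mdFib N NA a b (c + 1)).card * (c + 1) := by
  apply md_double_count (pAB N NA)
  · intro Δ hΔ
    rw [mem_mdFib] at hΔ
    have hf := md_freeA_card hN Δ hΔ.1
    have hg := md_freeB_card hN Δ hΔ.1
    have hx' : (mdFreeA NA Δ).card = x := by omega
    have hy' : (mdFreeB NA Δ).card = y := by omega
    have hinj : Set.InjOn (fun p : Fin N × Fin N => s(p.1, p.2))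
        (mdFreeA NA Δ ×ˢ mdFreeB NA Δ : Finset (Fin N × Fin N)) := by
      rintro ⟨u, v⟩ h1 ⟨u', v'⟩ h2 h3
      simp only [coe_product, Set.mem_prod, mem_coe, mem_mdFreeA, mem_mdFreeB] at h1 h2
      simp only [Sym2.eq_iff] at h3
      rcases h3 with ⟨rfl, rfl⟩ | ⟨rfl, rfl⟩
      · rfl
      · omega
    rw [← hx', ← hy', ← card_product, ← card_image_of_injOn hinj]
    congr 1
    ext e
    induction e using Sym2.ind with
    | _ u v =>
    simp only [mem_filter, mem_univ, true_and, mem_image, mem_product, Prod.exists, mem_mdFreeA,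
      mem_mdFreeB]
    constructor
    · rintro ⟨he, hp, hi⟩
      rw [mem_mdFib, isMD_insert he] at hi
      rw [pAB_mk] at hp
      rcases lt_or_ge (u : ℕ) NA with h1 | h1
      · exact ⟨u, v, ⟨⟨hi.1.2.2.1, h1⟩, ⟨hi.1.2.2.2, by omega⟩⟩, rfl⟩
      · exact ⟨v, u, ⟨⟨hi.1.2.2.2, by omega⟩, ⟨hi.1.2.2.1, h1⟩⟩, Sym2.eq_swap⟩
    · rintro ⟨u', v', ⟨⟨hu, hu1⟩, ⟨hv, hv1⟩⟩, heq⟩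
      have hne : u' ≠ v' := by rintro rfl; omega
      rw [← heq]
      have he := md_notMem (v := v') hu
      have hp : pAB N NA s(u', v') := (pAB_mk _ _).2 ⟨Or.inl hu1, Or.inr hv1⟩
      refine ⟨he, hp, ?_⟩
      obtain ⟨c1, c2, c3⟩ := md_counts_insert (NA := NA) he
      rw [mem_mdFib, isMD_insert he, c1, c2, c3]
      have := pAB_excl hp
      simp [hp, this, hΔ, hne]
      exact ⟨hu, hv⟩
  · intro Δ hΔ
    rw [mem_mdFib] at hΔ
    rw [← hΔ.2.2.2, countAB_eq]
    congr 1
    ext e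
    rw [mem_filter, mem_filter]
    refine and_congr_right fun he => ?_
    refine ⟨fun h => h.1, fun hp => ⟨hp, ?_⟩⟩
    obtain ⟨c1, c2, c3⟩ := md_counts_insert (NA := NA) (notMem_erase e Δ)
    rw [insert_erase he] at c1 c2 c3
    have := pAB_excl hp
    simp [hp, this, hΔ] at c1 c2 c3
    rw [mem_mdFib]
    exact ⟨isMD_mono (erase_subset _ _) hΔ.1, c1.symm, c2.symm, c3.symm⟩

lemma mdFib_zero : (mdFib N NA 0 0 0).card = 1 := by
  rw [card_eq_one]
  refine ⟨∅, ?_⟩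
  ext Δ
  rw [mem_mdFib, mem_singleton]
  constructor
  · rintro ⟨-, h1, h2, h3⟩
    rw [countA_eq, card_eq_zero, filter_eq_empty_iff] at h1
    rw [countB_eq, card_eq_zero, filter_eq_empty_iff] at h2
    rw [countAB_eq, card_eq_zero, filter_eq_empty_iff] at h3
    rw [eq_empty_iff_forall_notMem]
    intro e he
    have h1 := h1 he
    have h2 := h2 he
    have h3 := h3 he
    induction e using Sym2.ind with
    | _ u v => simp only [pA_mk, pB_mk, pAB_mk] at *; omega
  · rintro rfl
    simp [IsMDConfig, countA, countB, countAB]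

lemma two_mul_choose_two (x : ℕ) : (x + 2).choose 2 * 2 = (x + 2) * (x + 1) := by
  have := Nat.add_one_mul_choose_eq (x + 1) 1
  simp at this
  linarith

lemma mdFib_card (hN : NA ≤ N) (a b c x y : ℕ) (hx : 2 * a + c + x = NA)
    (hy : 2 * b + c + y = N - NA) :
    (mdFib N NA a b c).card * (a.factorial * b.factorial * c.factorial * 2 ^ a * 2 ^ b
      * x.factorial * y.factorial) = NA.factorial * (N - NA).factorial := by
  induction a generalizing x with
  | succ a ih =>
    rw [← ih (x + 2) (by omega)]
    have hr := mdFib_recA hN a b c (x + 2) (by omega)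
    have h2 := two_mul_choose_two x
    simp only [Nat.factorial_succ, pow_succ]
    calc _ = ((mdFib N NA (a + 1) b c).card * (a + 1)) * (a.factorial * b.factorial * c.factorial
            * (2 ^ a * 2) * 2 ^ b * x.factorial * y.factorial) := by ring
      _ = (mdFib N NA a b c).card * ((x + 2).choose 2 * 2) * (a.factorial * b.factorial * c.factorial
            * (2 ^ a) * 2 ^ b * x.factorial * y.factorial) := by rw [← hr]; ring
      _ = _ := by rw [h2]; ring
  | zero =>
  induction b generalizing y with
  | succ b ih =>
    rw [← ih (y + 2) (by omega)]
    have hr := mdFib_recB hN 0 b c (y + 2) (by omega)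
    have h2 := two_mul_choose_two y
    simp only [Nat.factorial_succ, pow_succ]
    calc _ = ((mdFib N NA 0 (b + 1) c).card * (b + 1)) * (Nat.factorial 0 * b.factorial * c.factorial
            * 2 ^ 0 * (2 ^ b * 2) * x.factorial * y.factorial) := by ring
      _ = (mdFib N NA 0 b c).card * ((y + 2).choose 2 * 2) * (Nat.factorial 0 * b.factorial
            * c.factorial * 2 ^ 0 * 2 ^ b * x.factorial * y.factorial) := by rw [← hr]; ring
      _ = _ := by rw [h2]; ring
  | zero =>
  induction c generalizing x y with
  | succ c ih =>
    rw [← ih (x + 1) (by omega) (y + 1) (by omega)]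
    have hr := mdFib_recAB hN 0 0 c (x + 1) (y + 1) (by omega) (by omega)
    simp only [Nat.factorial_succ, pow_succ]
    calc _ = ((mdFib N NA 0 0 (c + 1)).card * (c + 1)) * (Nat.factorial 0 * Nat.factorial 0
            * c.factorial * 2 ^ 0 * 2 ^ 0 * x.factorial * y.factorial) := by ring
      _ = _ := by rw [← hr]; ring
  | zero =>
    have : x = NA := by omega
    have : y = N - NA := by omega
    subst y x
    rw [mdFib_zero]
    simp

end Comb

/-! ### Analysis -/

def mdG (x : ℝ) : ℝ := x * Real.log x - x

lemma log_mdGamma (x : ℝ) : Real.log (mdGamma x) = mdG x := by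
  simp [mdGamma, mdG]

lemma mdG_scale (M n : ℝ) (hM : 0 < M) (hn : 0 ≤ n) :
    M * mdG (n / M) = mdG n - n * Real.log M := by
  unfold mdG
  rcases hn.eq_or_lt with rfl | hn
  · simp
  · rw [Real.log_div hn.ne' hM.ne']
    field_simp
    ring

lemma mdG_le_log_factorial (n : ℕ) : mdG n ≤ Real.log n.factorial := by
  rcases Nat.eq_zero_or_pos n with rfl | hn
  · simp [mdG]
  · have h1 := Stirling.le_log_factorial_stirling hn.ne'
    have h2 : 0 ≤ Real.log n := Real.log_natCast_nonneg n
    have h3 : 0 ≤ Real.log (2 * π) := Real.log_nonneg (by linarith [Real.pi_gt_three])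
    unfold mdG
    linarith

lemma log_factorial_le_mdG (n N : ℕ) (hnN : n ≤ N) :
    Real.log n.factorial ≤ mdG n + (Real.log N + 1) := by
  rcases Nat.eq_zero_or_pos n with rfl | hn
  · have h2 : 0 ≤ Real.log N := Real.log_natCast_nonneg N
    simp [mdG]
    linarith
  · have hn0 : (0 : ℝ) < n := by exact_mod_cast hn
    have h1 := Stirling.log_stirlingSeq_formula n
    have h2 : Real.log (Stirling.stirlingSeq n) ≤ Real.log (Stirling.stirlingSeq 1) := by
      have := Stirling.log_stirlingSeq'_antitone (Nat.zero_le (n - 1))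
      simpa [Nat.sub_add_cancel hn] using this
    have h3 : Real.log (Stirling.stirlingSeq 1) = 1 - Real.log 2 / 2 := by
      rw [Stirling.stirlingSeq_one, Real.log_div (Real.exp_pos 1).ne' (by positivity), Real.log_exp,
        Real.log_sqrt (by norm_num)]
    have h4 : Real.log (2 * n) = Real.log 2 + Real.log n := Real.log_mul (by norm_num) hn0.ne'
    have h5 : Real.log (n / Real.exp 1) = Real.log n - 1 := by
      rw [Real.log_div hn0.ne' (Real.exp_pos 1).ne', Real.log_exp]
    have h6 : Real.log n ≤ Real.log N := Real.log_le_log hn0 (by exact_mod_cast hnN)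
    have h7 : 0 ≤ Real.log n := Real.log_natCast_nonneg n
    rw [h4, h5] at h1
    unfold mdG
    linarith

lemma mdEnergy_scale (N : ℕ) (hN : 0 < N) (h : Fin 3 → ℝ) (J : Matrix (Fin 3) (Fin 3) ℝ)
    (a b c : ℝ) : mdHamiltonian N h J ![a, b, c] = N * mdEnergy h J ![a / N, b / N, c / N] := by
  have : (N : ℝ) ≠ 0 := by positivity
  simp only [mdHamiltonian, mdEnergy, Matrix.mulVec, dotProduct, Fin.sum_univ_three]
  simp
  field_simp

lemma mdEntropy_scale (α : ℝ) (N NA a b c x y : ℕ) (hN0 : 0 < N) (hN : NA ≤ N)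
    (hα : (NA : ℝ) = α * N) (hx : 2 * a + c + x = NA) (hy : 2 * b + c + y = N - NA) :
    N * mdEntropy α ![(a : ℝ) / N, (b : ℝ) / N, (c : ℝ) / N] =
      mdG NA + mdG (N - NA : ℕ) - mdG x - mdG y - mdG a - mdG b - mdG c
        - a * Real.log 2 - b * Real.log 2 - (a + b + c) * Real.log N := by
  have hN1 : (0 : ℝ) < N := by exact_mod_cast hN0
  have hxR : (2 * a + c + x : ℝ) = NA := by exact_mod_cast hx
  have hyR : (2 * b + c + y : ℝ) = ((N - NA : ℕ) : ℝ) := by exact_mod_cast hy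
  have hsub : ((N - NA : ℕ) : ℝ) = N - NA := by push_cast [hN]; ring
  have e1 : α = (NA : ℝ) / N := by rw [hα]; field_simp
  have e2 : 1 - α = ((N - NA : ℕ) : ℝ) / N := by rw [hsub, e1]; field_simp
  have e3 : α - 2 * ((a : ℝ) / N) - (c : ℝ) / N = (x : ℝ) / N := by
    rw [e1, ← hxR]; field_simp; ring
  have e4 : 1 - α - 2 * ((b : ℝ) / N) - (c : ℝ) / N = (y : ℝ) / N := by
    rw [e2, ← hyR]; field_simp; ring
  have s := fun n : ℕ => mdG_scale N n hN1 (Nat.cast_nonneg n)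
  have s1 := s NA
  have s2 := s (N - NA)
  have s3 := s x
  have s4 := s y
  have s5 := s a
  have s6 := s b
  have s7 := s c
  have q1 : (N : ℝ) * ((a : ℝ) / N * Real.log 2) = a * Real.log 2 := by field_simp
  have q2 : (N : ℝ) * ((b : ℝ) / N * Real.log 2) = b * Real.log 2 := by field_simp
  simp only [mdEntropy, log_mdGamma]
  simp only [Matrix.cons_val_zero, Matrix.cons_val_one, Matrix.cons_val]
  rw [e3, e4, e2, e1]
  simp only [mul_sub, mul_add, s1, s2, s3, s4, s5, s6, s7, q1, q2]
  rw [← hyR, ← hxR]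
  ring

/-- The total weight of the configurations with dimer numbers `(a, b, c)`. -/
def mdTerm (N NA : ℕ) (h : Fin 3 → ℝ) (J : Matrix (Fin 3) (Fin 3) ℝ) (a b c : ℕ) : ℝ :=
  ((mdFib N NA a b c).card : ℝ) * (((N : ℝ) ^ (a + b + c))⁻¹ *
      Real.exp (- mdHamiltonian N h J ![(a : ℝ), (b : ℝ), (c : ℝ)]))

lemma mdTerm_bounds (α : ℝ) (h : Fin 3 → ℝ) (J : Matrix (Fin 3) (Fin 3) ℝ)
    (N NA a b c x y : ℕ) (hN0 : 0 < N) (hN : NA ≤ N)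
    (hα : (NA : ℝ) = α * N) (hx : 2 * a + c + x = NA) (hy : 2 * b + c + y = N - NA) :
    0 < mdTerm N NA h J a b c ∧
    N * mdPsi h J α ![(a : ℝ) / N, (b : ℝ) / N, (c : ℝ) / N] - 5 * (Real.log N + 1)
      ≤ Real.log (mdTerm N NA h J a b c) ∧
    Real.log (mdTerm N NA h J a b c) ≤
      N * mdPsi h J α ![(a : ℝ) / N, (b : ℝ) / N, (c : ℝ) / N] + 2 * (Real.log N + 1) := by
  have hN1 : (0 : ℝ) < N := by exact_mod_cast hN0
  have hc := mdFib_card hN a b c x y hx hy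
  have hpos : 0 < (mdFib N NA a b c).card := by
    rcases Nat.eq_zero_or_pos (mdFib N NA a b c).card with h0 | h0
    · rw [h0, zero_mul] at hc
      exact absurd hc.symm (by positivity)
    · exact h0
  have hcR : ((mdFib N NA a b c).card : ℝ) * (a.factorial * b.factorial * c.factorial * 2 ^ a * 2 ^ b
      * x.factorial * y.factorial) = NA.factorial * (N - NA).factorial := by exact_mod_cast hc
  have hposR : (0 : ℝ) < (mdFib N NA a b c).card := by exact_mod_cast hpos
  have hlog := congrArg Real.log hcR
  have f := fun n : ℕ => (Nat.cast_pos (α := ℝ)).2 (Nat.factorial_pos n)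
  have f1 := (f a).ne'
  have f2 := (f b).ne'
  have f3 := (f c).ne'
  have f4 := (f x).ne'
  have f5 := (f y).ne'
  have f6 := (f NA).ne'
  have f7 := (f (N - NA)).ne'
  have p1 : (2 : ℝ) ^ a ≠ 0 := by positivity
  have p2 : (2 : ℝ) ^ b ≠ 0 := by positivity
  rw [Real.log_mul hposR.ne' (by positivity), Real.log_mul (by positivity) f5,
    Real.log_mul (by positivity) f4, Real.log_mul (by positivity) p2,
    Real.log_mul (by positivity) p1, Real.log_mul (by positivity) f3,
    Real.log_mul f1 f2, Real.log_mul f6 f7, Real.log_pow, Real.log_pow] at hlog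
  have ht : Real.log (mdTerm N NA h J a b c) = Real.log (mdFib N NA a b c).card
      - (a + b + c) * Real.log N - N * mdEnergy h J ![(a : ℝ) / N, (b : ℝ) / N, (c : ℝ) / N] := by
    rw [mdTerm, Real.log_mul hposR.ne' (by positivity), Real.log_mul (by positivity)
      (Real.exp_pos _).ne', Real.log_exp, Real.log_inv, Real.log_pow, mdEnergy_scale N hN0]
    push_cast
    ring
  have hs := mdEntropy_scale α N NA a b c x y hN0 hN hα hx hy
  refine ⟨by unfold mdTerm; positivity, ?_, ?_⟩ <;> rw [ht, mdPsi, mul_sub, hs]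
  · linarith [mdG_le_log_factorial NA, mdG_le_log_factorial (N - NA),
      log_factorial_le_mdG a N (by omega), log_factorial_le_mdG b N (by omega),
      log_factorial_le_mdG c N (by omega), log_factorial_le_mdG x N (by omega),
      log_factorial_le_mdG y N (by omega)]
  · linarith [mdG_le_log_factorial a, mdG_le_log_factorial b, mdG_le_log_factorial c,
      mdG_le_log_factorial x, mdG_le_log_factorial y,
      log_factorial_le_mdG NA N (by omega), log_factorial_le_mdG (N - NA) N (by omega)]

lemma mdTerm_nonneg (N NA : ℕ) (h : Fin 3 → ℝ) (J : Matrix (Fin 3) (Fin 3) ℝ) (a b c : ℕ) :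
    0 ≤ mdTerm N NA h J a b c := by
  unfold mdTerm; positivity

lemma mdZ_eq (N NA : ℕ) (hN : NA ≤ N) (h : Fin 3 → ℝ) (J : Matrix (Fin 3) (Fin 3) ℝ) :
    mdZ N NA h J = ∑ t ∈ Finset.range (N + 1) ×ˢ Finset.range (N + 1) ×ˢ Finset.range (N + 1),
      mdTerm N NA h J t.1 t.2.1 t.2.2 := by
  unfold mdZ
  rw [← Finset.sum_fiberwise_of_maps_to (s := mdConfigs N)
    (g := fun Δ => (countA N NA Δ, countB N NA Δ, countAB N NA Δ))
    (t := Finset.range (N + 1) ×ˢ Finset.range (N + 1) ×ˢ Finset.range (N + 1))]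
  · apply Finset.sum_congr rfl
    rintro ⟨a, b, c⟩ -
    have hset : (mdConfigs N).filter (fun Δ => (countA N NA Δ, countB N NA Δ, countAB N NA Δ)
        = (a, b, c)) = mdFib N NA a b c := by
      simp [mdFib]
    rw [hset, mdTerm, ← nsmul_eq_mul, ← Finset.sum_const]
    apply Finset.sum_congr rfl
    intro Δ hΔ
    obtain ⟨-, h1, h2, h3⟩ := mem_mdFib.1 hΔ
    rw [dimerVec, h1, h2, h3]
  · intro Δ hΔ
    have hc : IsMDConfig N Δ := by simpa [mdConfigs] using hΔ
    have h1 := md_freeA_card hN Δ hc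
    have h2 := md_freeB_card hN Δ hc
    simp only [Finset.mem_product, Finset.mem_range]
    omega

lemma mdZ_lower (N NA : ℕ) (hN : NA ≤ N) (h : Fin 3 → ℝ) (J : Matrix (Fin 3) (Fin 3) ℝ)
    (a b c : ℕ) (h1 : 2 * a + c ≤ NA) (h2 : 2 * b + c ≤ N - NA) :
    mdTerm N NA h J a b c ≤ mdZ N NA h J := by
  rw [mdZ_eq N NA hN]
  refine Finset.single_le_sum (f := fun t : ℕ × ℕ × ℕ => mdTerm N NA h J t.1 t.2.1 t.2.2)
    (fun t _ => mdTerm_nonneg _ _ _ _ _ _ _) (a := (a, b, c)) ?_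
  simp only [Finset.mem_product, Finset.mem_range]
  omega

lemma mdOmega_mem (α : ℝ) (N NA a b c : ℕ) (hN0 : 0 < N) (hN : NA ≤ N)
    (hα : (NA : ℝ) = α * N) (h1 : 2 * a + c ≤ NA) (h2 : 2 * b + c ≤ N - NA) :
    ![(a : ℝ) / N, (b : ℝ) / N, (c : ℝ) / N] ∈ mdOmega α := by
  have hN1 : (0 : ℝ) < N := by exact_mod_cast hN0
  have h1R : (2 * a + c : ℝ) ≤ NA := by exact_mod_cast h1
  have h2R : (2 * b + c + NA : ℝ) ≤ N := by
    have : 2 * b + c + NA ≤ N := by omega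
    exact_mod_cast this
  refine ⟨?_, ?_, ?_⟩
  · intro i
    fin_cases i <;> simp <;> positivity
  · simp only [Matrix.cons_val_zero, Matrix.cons_val]
    have : 2 * ((a : ℝ) / N) + (c : ℝ) / N = (2 * a + c) / N := by ring
    rw [this, div_le_iff₀ hN1]
    linarith
  · simp only [Matrix.cons_val_one, Matrix.cons_val]
    have : 2 * ((b : ℝ) / N) + (c : ℝ) / N = (2 * b + c) / N := by ring
    rw [this, div_le_iff₀ hN1]
    linarith

lemma mdZ_upper (α : ℝ) (h : Fin 3 → ℝ) (J : Matrix (Fin 3) (Fin 3) ℝ) (N NA : ℕ) (hN0 : 0 < N)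
    (hN : NA ≤ N) (hα : (NA : ℝ) = α * N) (M : ℝ) (hM : ∀ d ∈ mdOmega α, mdPsi h J α d ≤ M) :
    mdZ N NA h J ≤ ((N : ℝ) + 1) ^ 3 * Real.exp (N * M + 2 * (Real.log N + 1)) := by
  have hN1 : (0 : ℝ) < N := by exact_mod_cast hN0
  rw [mdZ_eq N NA hN]
  have : ∀ t ∈ Finset.range (N + 1) ×ˢ Finset.range (N + 1) ×ˢ Finset.range (N + 1),
      mdTerm N NA h J t.1 t.2.1 t.2.2 ≤ Real.exp (N * M + 2 * (Real.log N + 1)) := by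
    rintro ⟨a, b, c⟩ -
    rcases (mdFib N NA a b c).eq_empty_or_nonempty with he | ⟨Δ, hΔ⟩
    · simp only [mdTerm, he]
      simp
      positivity
    · obtain ⟨hc, h1, h2, h3⟩ := mem_mdFib.1 hΔ
      have hA := md_freeA_card hN Δ hc
      have hB := md_freeB_card hN Δ hc
      rw [h1, h3] at hA
      rw [h2, h3] at hB
      obtain ⟨hp, -, hu⟩ := mdTerm_bounds α h J N NA a b c (mdFreeA NA Δ).card (mdFreeB NA Δ).card
        hN0 hN hα (by omega) (by omega)
      rw [← Real.log_le_iff_le_exp hp]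
      have hm := hM _ (mdOmega_mem α N NA a b c hN0 hN hα (by omega) (by omega))
      have := mul_le_mul_of_nonneg_left hm hN1.le
      linarith
  refine (Finset.sum_le_card_nsmul _ _ _ this).trans (le_of_eq ?_)
  simp [Finset.card_product]
  ring

lemma mdPsi_continuous (h : Fin 3 → ℝ) (J : Matrix (Fin 3) (Fin 3) ℝ) (α : ℝ) :
    Continuous (mdPsi h J α) := by
  have hG : Continuous mdG := Real.continuous_mul_log.sub continuous_id
  unfold mdPsi mdEntropy mdEnergy
  simp only [log_mdGamma, Matrix.mulVec, dotProduct, Fin.sum_univ_three]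
  fun_prop

lemma mdOmega_compact (α : ℝ) (hα : α ∈ Set.Ioo (0 : ℝ) 1) : IsCompact (mdOmega α) := by
  refine IsCompact.of_isClosed_subset (isCompact_Icc (a := (0 : Fin 3 → ℝ)) (b := 1)) ?_ ?_
  · have e : mdOmega α = (⋂ i, {d : Fin 3 → ℝ | 0 ≤ d i}) ∩ ({d | 2 * d 0 + d 2 ≤ α} ∩
        {d | 2 * d 1 + d 2 ≤ 1 - α}) := by
      ext d; simp [mdOmega]
    rw [e]
    refine (isClosed_iInter fun i => ?_).inter (IsClosed.inter ?_ ?_)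
    · exact isClosed_le (by fun_prop) (by fun_prop)
    · exact isClosed_le (by fun_prop) (by fun_prop)
    · exact isClosed_le (by fun_prop) (by fun_prop)
  · rintro d ⟨h0, h1, h2⟩
    refine ⟨h0, ?_⟩
    intro i
    have a0 := h0 0
    have a1 := h0 1
    have a2 := h0 2
    obtain ⟨hα0, hα1⟩ := hα
    fin_cases i <;> simp <;> linarith

theorem stmt0 (α : ℝ) (hα : α ∈ Set.Ioo (0 : ℝ) 1) (hαQ : ∃ q : ℚ, (q : ℝ) = α)
    (h : Fin 3 → ℝ) (J : Matrix (Fin 3) (Fin 3) ℝ) :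
    ∃ dstar ∈ mdOmega α, IsMaxOn (mdPsi h J α) (mdOmega α) dstar ∧
      Tendsto (fun N : ℕ => (N : ℝ)⁻¹ * Real.log (mdZ N ⌊α * N⌋₊ h J))
        (atTop ⊓ 𝓟 {N : ℕ | ∃ m : ℕ, (m : ℝ) = α * N})
        (𝓝 (mdPsi h J α dstar)) := by
  have hne : (mdOmega α).Nonempty :=
    ⟨0, fun i => le_rfl, by simpa using hα.1.le, by simpa using hα.2.le⟩
  obtain ⟨d, hd, hmax⟩ := (mdOmega_compact α hα).exists_isMaxOn hne
    (mdPsi_continuous h J α).continuousOn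
  refine ⟨d, hd, hmax, ?_⟩
  obtain ⟨hd0, hd1, hd2⟩ := id hd
  have hr : Tendsto (fun N : ℕ => 5 * (Real.log N + 1) / (N : ℝ)) atTop (𝓝 0) := by
    have h1 : Tendsto (fun N : ℕ => Real.log N / (N : ℝ)) atTop (𝓝 0) :=
      (Real.isLittleO_log_id_atTop.tendsto_div_nhds_zero).comp tendsto_natCast_atTop_atTop
    have h2 : Tendsto (fun N : ℕ => (1 : ℝ) / (N : ℝ)) atTop (𝓝 0) :=
      tendsto_const_div_atTop_nhds_zero_nat 1
    have h3 := (h1.add h2).const_mul 5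
    simp only [add_zero, mul_zero] at h3
    refine h3.congr fun N => ?_
    ring
  have hf : ∀ i, Tendsto (fun N : ℕ => (⌊d i * N⌋₊ : ℝ) / (N : ℝ)) atTop (𝓝 (d i)) := fun i =>
    (tendsto_nat_floor_mul_div_atTop (hd0 i)).comp tendsto_natCast_atTop_atTop
  have hv : Tendsto (fun N : ℕ => ![(⌊d 0 * N⌋₊ : ℝ) / (N : ℝ), (⌊d 1 * N⌋₊ : ℝ) / (N : ℝ),
      (⌊d 2 * N⌋₊ : ℝ) / (N : ℝ)]) atTop (𝓝 d) := by
    rw [tendsto_pi_nhds]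
    intro i
    fin_cases i
    · exact hf 0
    · exact hf 1
    · exact hf 2
  have hlow := (((mdPsi_continuous h J α).tendsto d).comp hv).sub hr
  have hup := hr.const_add (mdPsi h J α d)
  rw [sub_zero] at hlow
  rw [add_zero] at hup
  have hev : ∀ᶠ N : ℕ in atTop ⊓ 𝓟 {N : ℕ | ∃ m : ℕ, (m : ℝ) = α * N},
      0 < N ∧ ∃ m : ℕ, (m : ℝ) = α * N :=
    ((eventually_gt_atTop 0).filter_mono inf_le_left).and
      ((eventually_principal.2 fun N hN => hN).filter_mono inf_le_right)
  have key : ∀ N : ℕ, ∀ m : ℕ, (m : ℝ) = α * N → ⌊α * N⌋₊ = m := by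
    intro N m hm; rw [← hm, Nat.floor_natCast]
  refine tendsto_of_tendsto_of_tendsto_of_le_of_le' (hlow.mono_left inf_le_left)
    (hup.mono_left inf_le_left) ?_ ?_
  · filter_upwards [hev] with N ⟨hN0, m, hm⟩
    rw [key N m hm]
    have hN1 : (0 : ℝ) < N := by exact_mod_cast hN0
    have hmN : m ≤ N := by
      have : (m : ℝ) ≤ N := by rw [hm]; nlinarith [hα.2]
      exact_mod_cast this
    have fl := fun i => Nat.floor_le (mul_nonneg (hd0 i) hN1.le)
    have f0 := fl 0
    have f1 := fl 1
    have f2 := fl 2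
    have hA : 2 * ⌊d 0 * N⌋₊ + ⌊d 2 * N⌋₊ ≤ m := by
      have : (2 * ⌊d 0 * N⌋₊ + ⌊d 2 * N⌋₊ : ℝ) ≤ m := by
        rw [hm]
        have := mul_le_mul_of_nonneg_right hd1 hN1.le
        linarith
      exact_mod_cast this
    have hB : 2 * ⌊d 1 * N⌋₊ + ⌊d 2 * N⌋₊ + m ≤ N := by
      have : (2 * ⌊d 1 * N⌋₊ + ⌊d 2 * N⌋₊ + m : ℝ) ≤ N := by
        rw [hm]
        have := mul_le_mul_of_nonneg_right hd2 hN1.le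
        linarith
      exact_mod_cast this
    obtain ⟨hp, hl, -⟩ := mdTerm_bounds α h J N m ⌊d 0 * N⌋₊ ⌊d 1 * N⌋₊ ⌊d 2 * N⌋₊
      (m - (2 * ⌊d 0 * N⌋₊ + ⌊d 2 * N⌋₊)) (N - m - (2 * ⌊d 1 * N⌋₊ + ⌊d 2 * N⌋₊)) hN0 hmN hm
      (by omega) (by omega)
    have hz := Real.log_le_log hp (mdZ_lower N m hmN h J ⌊d 0 * N⌋₊ ⌊d 1 * N⌋₊ ⌊d 2 * N⌋₊
      (by omega) (by omega))
    have := mul_le_mul_of_nonneg_left (hl.trans hz) (inv_pos.2 hN1).le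
    refine le_trans (le_of_eq ?_) this
    simp only [Function.comp]
    field_simp
  · filter_upwards [hev] with N ⟨hN0, m, hm⟩
    rw [key N m hm]
    have hN1 : (0 : ℝ) < N := by exact_mod_cast hN0
    have hmN : m ≤ N := by
      have : (m : ℝ) ≤ N := by rw [hm]; nlinarith [hα.2]
      exact_mod_cast this
    have hz := mdZ_upper α h J N m hN0 hmN hm (mdPsi h J α d) (fun d' hd' => hmax hd')
    have hp : 0 < mdZ N m h J :=
      (mdTerm_bounds α h J N m 0 0 0 m (N - m) hN0 hmN hm (by omega) (by omega)).1.trans_le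
        (mdZ_lower N m hmN h J 0 0 0 (by omega) (by omega))
    have hl := Real.log_le_log hp hz
    rw [Real.log_mul (by positivity) (Real.exp_pos _).ne', Real.log_exp, Real.log_pow] at hl
    have h2 : Real.log ((N : ℝ) + 1) ≤ Real.log N + 1 := by
      have h3 : (N : ℝ) + 1 ≤ N * Real.exp 1 := by
        have h4 : (1 : ℝ) ≤ N := by exact_mod_cast hN0
        have h5 : (2 : ℝ) ≤ Real.exp 1 := by linarith [Real.add_one_le_exp (1 : ℝ)]
        nlinarith
      have := Real.log_le_log (by positivity) h3
      rwa [Real.log_mul hN1.ne' (Real.exp_pos 1).ne', Real.log_exp] at this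
    have hl2 : Real.log (mdZ N m h J) ≤ N * mdPsi h J α d + 5 * (Real.log N + 1) := by
      push_cast at hl
      linarith
    refine (mul_le_mul_of_nonneg_left hl2 (inv_pos.2 hN1).le).trans (le_of_eq ?_)
    field_simp
end
end

section
/- For every natural number n, max(1, √(2πn)) ≤ n!/γ(n) ≤ max(1, e^{1/12}·√(2πn)), where γ(x) = exp(x·log x − x) for x > 0 and γ(0) = 1. -/
noncomputable section
open Real

theorem aux_upper (n : ℕ) :
    Stirling.stirlingSeq (n + 1) ≤ Real.exp (1 / 12) * √Real.pi := by
  have h1 : Stirling.stirlingSeq (n + 1) ≤ Stirling.stirlingSeq 1 :=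
    Stirling.stirlingSeq'_antitone (Nat.zero_le n)
  refine h1.trans ?_
  have h2 : ∀ m : ℕ, Stirling.stirlingSeq 1 ≤
      Real.exp (1 / 12) * Stirling.stirlingSeq (m + 1) := by
    intro m
    have h := Stirling.log_stirlingSeq_bounded_aux m
    have p1 := Stirling.stirlingSeq'_pos 0
    have p2 := Stirling.stirlingSeq'_pos m
    rw [zero_add] at p1
    rw [← Real.log_le_log_iff p1 (by positivity), Real.log_mul (by positivity) p2.ne',
      Real.log_exp]
    linarith
  refine ge_of_tendsto' (x := Filter.atTop) (Filter.Tendsto.const_mul (Real.exp (1 / 12)) ?_) h2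
  exact Stirling.tendsto_stirlingSeq_sqrt_pi.comp (Filter.tendsto_add_atTop_nat 1)

theorem aux_eq (n : ℕ) (hn : n ≠ 0) :
    (Nat.factorial n : ℝ) / mdGamma n = Stirling.stirlingSeq n * √(2 * n) := by
  have hp : (0 : ℝ) < n := by positivity
  have hg : mdGamma n = (n / Real.exp 1) ^ n := by
    rw [mdGamma, Real.exp_sub, div_pow, ← Real.exp_nat_mul, mul_one, Real.exp_nat_mul,
      Real.exp_log hp]
  rw [hg, Stirling.stirlingSeq]
  have : √(2 * (n : ℝ)) ≠ 0 := by positivity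
  field_simp

theorem stmt2 (n : ℕ) :
    max 1 (Real.sqrt (2 * Real.pi * n)) ≤ (Nat.factorial n : ℝ) / mdGamma n ∧
      (Nat.factorial n : ℝ) / mdGamma n ≤ max 1 (Real.exp (1 / 12) * Real.sqrt (2 * Real.pi * n)) := by
  rcases n with _ | k
  · simp [mdGamma]
  have hs : √(2 * Real.pi * ((k + 1 : ℕ) : ℝ)) = √Real.pi * √(2 * ((k + 1 : ℕ) : ℝ)) := by
    rw [← Real.sqrt_mul Real.pi_pos.le]
    congr 1
    ring
  rw [aux_eq _ (Nat.succ_ne_zero k), hs]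
  have hl : √Real.pi * √(2 * ((k + 1 : ℕ) : ℝ)) ≤
      Stirling.stirlingSeq (k + 1) * √(2 * ((k + 1 : ℕ) : ℝ)) :=
    mul_le_mul_of_nonneg_right (Stirling.sqrt_pi_le_stirlingSeq (Nat.succ_ne_zero k))
      (Real.sqrt_nonneg _)
  refine ⟨max_le (le_trans ?_ hl) hl, le_max_of_le_right ?_⟩
  · rw [← hs, Real.one_le_sqrt]
    have := Real.pi_gt_three
    push_cast
    have : (0 : ℝ) ≤ k := Nat.cast_nonneg k
    nlinarith
  · rw [← mul_assoc]
    exact mul_le_mul_of_nonneg_right (aux_upper k) (Real.sqrt_nonneg _)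
end
end

section
/- For J = 0, every α ∈ (0,1) and every h ∈ ℝ³, the fixed point system d_A = (e^{h_A}/2)·m_A², d_B = (e^{h_B}/2)·m_B², d_AB = e^{h_AB}·m_A·m_B (with m_A = α − 2d_A − d_AB, m_B = 1 − α − 2d_B − d_AB) has a unique solution d* = g(h,α) in Ω_α, and g is a real-analytic function of (h,α) on ℝ³ × (0,1). -/
noncomputable section
open Real

/-- The fixed point system at J = 0:
`d_A = (e^{h_A}/2) m_A²`, `d_B = (e^{h_B}/2) m_B²`, `d_AB = e^{h_AB} m_A m_B`. -/
def FixedPointJ0 (h : Fin 3 → ℝ) (α : ℝ) (d : Fin 3 → ℝ) : Prop :=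
  d 0 = Real.exp (h 0) / 2 * (α - 2 * d 0 - d 2) ^ 2 ∧
  d 1 = Real.exp (h 1) / 2 * (1 - α - 2 * d 1 - d 2) ^ 2 ∧
  d 2 = Real.exp (h 2) * ((α - 2 * d 0 - d 2) * (1 - α - 2 * d 1 - d 2))

lemma md_unique_aux {a b c x y x' y' : ℝ} (ha : 0 < a) (hb : 0 < b) (hc : 0 < c)
    (hx : 0 ≤ x) (hy : 0 ≤ y) (hx' : 0 ≤ x') (hy' : 0 ≤ y')
    (h1 : x + a * x ^ 2 + c * (x * y) = x' + a * x' ^ 2 + c * (x' * y'))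
    (h2 : y + b * y ^ 2 + c * (x * y) = y' + b * y' ^ 2 + c * (x' * y')) : ¬ x < x' := by
  intro hlt
  have e1 : a * x ^ 2 ≤ a * x' ^ 2 := by gcongr
  have s1 : c * (x' * y') < c * (x * y) := by linarith
  have hyy : y' < y := by
    by_contra hcon
    push Not at hcon
    have : c * (x * y) ≤ c * (x' * y') := by gcongr
    linarith
  have e2 : b * y' ^ 2 ≤ b * y ^ 2 := by gcongr
  linarith

lemma md_unique {a b c x y x' y' : ℝ} (ha : 0 < a) (hb : 0 < b) (hc : 0 < c)
    (hx : 0 ≤ x) (hy : 0 ≤ y) (hx' : 0 ≤ x') (hy' : 0 ≤ y')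
    (h1 : x + a * x ^ 2 + c * (x * y) = x' + a * x' ^ 2 + c * (x' * y'))
    (h2 : y + b * y ^ 2 + c * (x * y) = y' + b * y' ^ 2 + c * (x' * y')) : x = x' ∧ y = y' := by
  constructor
  · exact le_antisymm (not_lt.1 (md_unique_aux ha hb hc hx' hy' hx hy h1.symm h2.symm))
      (not_lt.1 (md_unique_aux ha hb hc hx hy hx' hy' h1 h2))
  · rw [mul_comm x, mul_comm x'] at h1 h2
    exact le_antisymm (not_lt.1 (md_unique_aux hb ha hc hy' hx' hy hx h2.symm h1.symm))
      (not_lt.1 (md_unique_aux hb ha hc hy hx hy' hx' h2 h1))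

lemma md_exists {a b c α β : ℝ} (ha : 0 < a) (hb : 0 < b) (hc : 0 < c) (hα : 0 < α) (hβ : 0 < β) :
    ∃ x y : ℝ, 0 < x ∧ 0 < y ∧ x + a * x ^ 2 + c * (x * y) = α ∧
      y + b * y ^ 2 + c * (x * y) = β := by
  let X : ℝ → ℝ := fun y => (√((1 + c * y) ^ 2 + 4 * a * α) - (1 + c * y)) / (2 * a)
  have hXc : Continuous X := by unfold X; fun_prop
  have hX0 : ∀ y, 0 < X y := by
    intro y
    have : 1 + c * y < √((1 + c * y) ^ 2 + 4 * a * α) := by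
      apply Real.lt_sqrt_of_sq_lt
      have : 0 < 4 * a * α := by positivity
      linarith
    exact div_pos (by linarith) (by linarith)
  have hXe : ∀ y, X y + a * X y ^ 2 + c * (X y * y) = α := by
    intro y
    have h0 : 0 ≤ (1 + c * y) ^ 2 + 4 * a * α := by positivity
    have hs := Real.sq_sqrt h0
    have hr : √((1 + c * y) ^ 2 + 4 * a * α) = 2 * a * X y + (1 + c * y) := by
      simp only [X]; field_simp; ring
    rw [hr] at hs
    have : 4 * a * (X y + a * X y ^ 2 + c * (X y * y) - α) = 0 := by linear_combination hs
    rcases mul_eq_zero.1 this with h | h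
    · linarith
    · linarith
  obtain ⟨y, hy, hye⟩ := intermediate_value_Icc hβ.le
    (f := fun y => y + b * y ^ 2 + c * (X y * y)) (by fun_prop)
    (show β ∈ Set.Icc _ _ from ⟨by simp [hβ.le], by
      have := hX0 β
      have : 0 ≤ b * β ^ 2 + c * (X β * β) := by positivity
      linarith⟩)
  refine ⟨X y, y, hX0 y, ?_, hXe y, hye⟩
  rcases hy.1.lt_or_eq with h | h
  · exact h
  · subst h; simp at hye; exact absurd hye.symm hβ.ne'

/-- The system in the monomer variables. -/
def mdF : ((Fin 3 → ℝ) × ℝ) × (ℝ × ℝ) → ℝ × ℝ := fun q =>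
  (q.2.1 + Real.exp (q.1.1 0) * q.2.1 ^ 2 + Real.exp (q.1.1 2) * (q.2.1 * q.2.2) - q.1.2,
   q.2.2 + Real.exp (q.1.1 1) * q.2.2 ^ 2 + Real.exp (q.1.1 2) * (q.2.1 * q.2.2) - (1 - q.1.2))

lemma md_contDiff : ContDiff ℝ ⊤ mdF := by
  unfold mdF; fun_prop

lemma md_fderiv (p : (Fin 3 → ℝ) × ℝ) (x y v w : ℝ) :
    fderiv ℝ mdF (p, (x, y)) (0, (v, w)) =
      (v + Real.exp (p.1 0) * (2 * x * v) + Real.exp (p.1 2) * (v * y + x * w),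
       w + Real.exp (p.1 1) * (2 * y * w) + Real.exp (p.1 2) * (v * y + x * w)) := by
  have hd : HasFDerivAt mdF (fderiv ℝ mdF (p, (x, y))) (p, (x, y)) :=
    ((md_contDiff.differentiable (by simp)) _).hasFDerivAt
  have hx : HasDerivAt (fun t : ℝ => x + t * v) v 0 := by
    simpa using ((hasDerivAt_id (0 : ℝ)).mul_const v).const_add x
  have hy : HasDerivAt (fun t : ℝ => y + t * w) w 0 := by
    simpa using ((hasDerivAt_id (0 : ℝ)).mul_const w).const_add y
  have hl : HasDerivAt (fun t : ℝ => (p, (x + t * v, y + t * w))) (0, (v, w)) 0 :=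
    (hasDerivAt_const _ _).prodMk (hx.prodMk hy)
  have h1 := HasFDerivAt.comp_hasDerivAt_of_eq (0 : ℝ) hd hl (by simp)
  have h2 : HasDerivAt (mdF ∘ fun t : ℝ => (p, (x + t * v, y + t * w))) _ 0 :=
    (((hx.add ((hx.pow 2).const_mul (Real.exp (p.1 0)))).add
      ((hx.mul hy).const_mul (Real.exp (p.1 2)))).sub_const p.2).prodMk
    (((hy.add ((hy.pow 2).const_mul (Real.exp (p.1 1)))).add
      ((hx.mul hy).const_mul (Real.exp (p.1 2)))).sub_const (1 - p.2))
  rw [h1.unique h2]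
  simp

lemma md_invertible (p : (Fin 3 → ℝ) × ℝ) {x y : ℝ} (hx : 0 < x) (hy : 0 < y) :
    (fderiv ℝ mdF (p, (x, y)) ∘L .inr ℝ ((Fin 3 → ℝ) × ℝ) (ℝ × ℝ)).IsInvertible := by
  set L := fderiv ℝ mdF (p, (x, y)) ∘L .inr ℝ ((Fin 3 → ℝ) × ℝ) (ℝ × ℝ) with hL
  have hinj : Function.Injective (L : (ℝ × ℝ) →ₗ[ℝ] (ℝ × ℝ)) := by
    rw [injective_iff_map_eq_zero]
    rintro ⟨v, w⟩ h
    have h' : fderiv ℝ mdF (p, (x, y)) (0, (v, w)) = 0 := by simpa [hL] using h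
    rw [md_fderiv, Prod.mk_eq_zero] at h'
    obtain ⟨h1, h2⟩ := h'
    have ha := Real.exp_pos (p.1 0)
    have hb := Real.exp_pos (p.1 1)
    have hc := Real.exp_pos (p.1 2)
    generalize Real.exp (p.1 0) = a at *
    generalize Real.exp (p.1 1) = b at *
    generalize Real.exp (p.1 2) = c at *
    have hD : 0 < (1 + 2 * a * x + c * y) * (1 + 2 * b * y) + (1 + 2 * a * x) * (c * x) := by
      positivity
    have hv : ((1 + 2 * a * x + c * y) * (1 + 2 * b * y) + (1 + 2 * a * x) * (c * x)) * v = 0 := by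
      linear_combination (1 + 2 * b * y + c * x) * h1 - c * x * h2
    have hw : ((1 + 2 * a * x + c * y) * (1 + 2 * b * y) + (1 + 2 * a * x) * (c * x)) * w = 0 := by
      linear_combination (1 + 2 * a * x + c * y) * h2 - c * y * h1
    have hv0 := (mul_eq_zero.1 hv).resolve_left hD.ne'
    have hw0 := (mul_eq_zero.1 hw).resolve_left hD.ne'
    simp [hv0, hw0]
  refine ⟨(LinearEquiv.ofInjectiveEndo _ hinj).toContinuousLinearEquiv, ?_⟩
  ext <;> rfl

lemma md_exists' (p : (Fin 3 → ℝ) × ℝ) : ∃ z : ℝ × ℝ, p.2 ∈ Set.Ioo (0 : ℝ) 1 →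
    0 < z.1 ∧ 0 < z.2 ∧ mdF (p, z) = 0 := by
  by_cases hp : p.2 ∈ Set.Ioo (0 : ℝ) 1
  · obtain ⟨x, y, hx, hy, h1, h2⟩ := md_exists (Real.exp_pos (p.1 0)) (Real.exp_pos (p.1 1))
      (Real.exp_pos (p.1 2)) hp.1 (sub_pos.2 hp.2)
    exact ⟨(x, y), fun _ => ⟨hx, hy, by simp [mdF, h1, h2]⟩⟩
  · exact ⟨0, fun h => absurd h hp⟩

lemma mdF_unique {p : (Fin 3 → ℝ) × ℝ} {z z' : ℝ × ℝ} (h1 : 0 ≤ z.1) (h2 : 0 ≤ z.2)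
    (h1' : 0 ≤ z'.1) (h2' : 0 ≤ z'.2) (h : mdF (p, z) = 0) (h' : mdF (p, z') = 0) : z = z' := by
  simp only [mdF, Prod.mk_eq_zero] at h h'
  have := md_unique (Real.exp_pos (p.1 0)) (Real.exp_pos (p.1 1))
      (Real.exp_pos (p.1 2)) h1 h2 h1' h2' (by linarith) (by linarith)
  exact Prod.ext this.1 this.2

theorem stmt6 :
    ∃ g : (Fin 3 → ℝ) × ℝ → (Fin 3 → ℝ),
      AnalyticOnNhd ℝ g {p : (Fin 3 → ℝ) × ℝ | p.2 ∈ Set.Ioo (0 : ℝ) 1} ∧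
      ∀ (h : Fin 3 → ℝ) (α : ℝ), α ∈ Set.Ioo (0 : ℝ) 1 →
        g (h, α) ∈ mdOmega α ∧ FixedPointJ0 h α (g (h, α)) ∧
          ∀ d ∈ mdOmega α, FixedPointJ0 h α d → d = g (h, α) := by
  choose m hm using md_exists'
  have hma : AnalyticOnNhd ℝ m {p : (Fin 3 → ℝ) × ℝ | p.2 ∈ Set.Ioo (0 : ℝ) 1} := by
    intro p hp
    obtain ⟨h1, h2, h0⟩ := hm p hp
    have hopen : IsOpen {p : (Fin 3 → ℝ) × ℝ | p.2 ∈ Set.Ioo (0 : ℝ) 1} :=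
      isOpen_Ioo.preimage continuous_snd
    have cdf : ContDiffAt ℝ ⊤ mdF (p, m p) := md_contDiff.contDiffAt
    have inv := md_invertible p h1 h2
    have hne : (⊤ : WithTop ℕ∞) ≠ 0 := by simp
    have hψ : AnalyticAt ℝ (cdf.implicitFunction hne inv) p :=
      (cdf.contDiffAt_implicitFunction hne inv).analyticAt
    have hψp : cdf.implicitFunction hne inv p = m p := cdf.implicitFunction_apply_self hne inv
    have hev := cdf.eventually_apply_implicitFunction hne inv
    refine hψ.congr ?_
    have e1 : ∀ᶠ q in nhds p, 0 < (cdf.implicitFunction hne inv q).1 :=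
      (continuous_fst.continuousAt.comp hψ.continuousAt).eventually_const_lt (by simpa [hψp] using h1)
    have e2 : ∀ᶠ q in nhds p, 0 < (cdf.implicitFunction hne inv q).2 :=
      (continuous_snd.continuousAt.comp hψ.continuousAt).eventually_const_lt (by simpa [hψp] using h2)
    filter_upwards [hev, e1, e2, hopen.mem_nhds hp] with q hq hq1 hq2 hqo
    obtain ⟨k1, k2, k0⟩ := hm q hqo
    exact mdF_unique hq1.le hq2.le k1.le k2.le (hq.trans h0) k0
  refine ⟨fun p => ![Real.exp (p.1 0) / 2 * (m p).1 ^ 2, Real.exp (p.1 1) / 2 * (m p).2 ^ 2,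
    Real.exp (p.1 2) * ((m p).1 * (m p).2)], ?_, ?_⟩
  · intro p hp
    have hmp := hma p hp
    have hm1 : AnalyticAt ℝ (fun q => (m q).1) p := analyticAt_fst.comp hmp
    have hm2 : AnalyticAt ℝ (fun q => (m q).2) p := analyticAt_snd.comp hmp
    have he : ∀ i, AnalyticAt ℝ (fun q : (Fin 3 → ℝ) × ℝ => Real.exp (q.1 i)) p := by
      intro i
      have : ContDiff ℝ ⊤ (fun q : (Fin 3 → ℝ) × ℝ => Real.exp (q.1 i)) := by fun_prop
      exact this.contDiffAt.analyticAt
    rw [analyticAt_pi_iff]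
    intro i
    fin_cases i
    · exact ((he 0).div_const).mul (hm1.pow 2)
    · exact ((he 1).div_const).mul (hm2.pow 2)
    · exact (he 2).mul (hm1.mul hm2)
  · intro h α hα
    obtain ⟨h1, h2, h0⟩ := hm (h, α) hα
    have h0' := h0
    simp only [mdF, Prod.mk_eq_zero] at h0'
    obtain ⟨f1, f2⟩ := h0'
    refine ⟨⟨?_, ?_, ?_⟩, ⟨?_, ?_, ?_⟩, ?_⟩
    · intro i
      fin_cases i <;> simp <;> positivity
    · simp; linarith
    · simp; linarith
    · simp
      congr 1; linarith
    · simp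
      congr 1; linarith
    · simp
      congr 1 <;> linarith
    · rintro d ⟨-, g1, g2⟩ ⟨q0, q1, q2⟩
      have hu : ((α - 2 * d 0 - d 2, 1 - α - 2 * d 1 - d 2) : ℝ × ℝ) = m (h, α) := by
        refine mdF_unique (p := (h, α)) (by simp only; linarith) (by simp only; linarith)
          h1.le h2.le ?_ h0
        simp only [mdF, Prod.mk_eq_zero]
        constructor <;> linarith
      have hu1 := congrArg Prod.fst hu
      have hu2 := congrArg Prod.snd hu
      simp only at hu1 hu2
      rw [hu1] at q0 q2
      rw [hu2] at q1 q2
      ext i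
      fin_cases i
      · exact q0
      · exact q1
      · exact q2
end
end

section
/- Let d_c(α) ∈ (0,α) denote the unique zero of f_α''. Then there exist constants C > 0 and α₀ > 0 such that |d_c(α) − α/2| ≤ C·α³ for all α ∈ (0,α₀). -/
noncomputable section
open Real Filter Topology

/-- x_α(d): the positive root of x² + x − (α − d) = 0. -/
def xFun (α d : ℝ) : ℝ := (-1 + Real.sqrt (1 + 4 * (α - d))) / 2

/-- y_α(d): the positive root of y² + y − (1 − α − d) = 0. -/
def yFun (α d : ℝ) : ℝ := (-1 + Real.sqrt (1 + 4 * (1 - α - d))) / 2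

/-- f_α(d) = log d − log x_α(d) − log y_α(d). -/
def fFun (α d : ℝ) : ℝ := Real.log d - Real.log (xFun α d) - Real.log (yFun α d)

theorem xFun_pos {c d : ℝ} (h : d < c) : 0 < xFun c d := by
  unfold xFun
  have : 1 < Real.sqrt (1 + 4 * (c - d)) := by
    rw [Real.lt_sqrt (by norm_num)]; linarith
  linarith

theorem xFun_eq {c d : ℝ} (h : d < c) : xFun c d ^ 2 + xFun c d = c - d := by
  unfold xFun
  have : Real.sqrt (1 + 4 * (c - d)) ^ 2 = 1 + 4 * (c - d) := Real.sq_sqrt (by linarith)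
  linear_combination this / 4

theorem xFun_deriv {c d : ℝ} (h : d < c) :
    HasDerivAt (xFun c) (-1 / (2 * xFun c d + 1)) d := by
  have h1 : HasDerivAt (fun t : ℝ => 1 + 4 * (c - t)) (4 * (-1)) d :=
    (((hasDerivAt_id d).const_sub c).const_mul 4).const_add 1
  have h2 := ((h1.sqrt (by linarith)).const_add (-1)).div_const 2
  refine h2.congr_deriv ?_
  have e : 2 * xFun c d + 1 = Real.sqrt (1 + 4 * (c - d)) := by unfold xFun; ring
  rw [e]
  have : 0 < Real.sqrt (1 + 4 * (c - d)) := Real.sqrt_pos.2 (by linarith)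
  field_simp
  norm_num

theorem log_xFun_deriv {c d : ℝ} (h : d < c) :
    HasDerivAt (fun t => Real.log (xFun c t)) (-1 / (xFun c d * (2 * xFun c d + 1))) d := by
  have hx := xFun_pos h
  refine ((xFun_deriv h).log hx.ne').congr_deriv ?_
  field_simp

theorem log_xFun_deriv2 {c d : ℝ} (h : d < c) :
    HasDerivAt (fun t => -1 / (xFun c t * (2 * xFun c t + 1)))
      (-(4 * xFun c d + 1) / (xFun c d ^ 2 * (2 * xFun c d + 1) ^ 3)) d := by
  have hx := xFun_pos h
  have h1 := xFun_deriv h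
  have h2 := h1.mul ((h1.const_mul 2).add_const 1)
  refine ((hasDerivAt_const d (-1 : ℝ)).div h2 (by simp only [Pi.mul_apply]; positivity)).congr_deriv ?_
  simp only [Pi.mul_apply]
  field_simp
  ring

theorem fFun_deriv2 {α d : ℝ} (h0 : 0 < d) (h : d < α) (h' : α < 1 - α) :
    deriv (deriv (fFun α)) d = -1 / d ^ 2
      + (4 * xFun α d + 1) / (xFun α d ^ 2 * (2 * xFun α d + 1) ^ 3)
      + (4 * xFun (1 - α) d + 1) / (xFun (1 - α) d ^ 2 * (2 * xFun (1 - α) d + 1) ^ 3) := by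
  have hE : deriv (fFun α) =ᶠ[𝓝 d] fun t => t⁻¹ - (-1 / (xFun α t * (2 * xFun α t + 1)))
      - (-1 / (xFun (1 - α) t * (2 * xFun (1 - α) t + 1))) := by
    filter_upwards [Ioo_mem_nhds h0 h] with t ht
    have := ((Real.hasDerivAt_log ht.1.ne').sub (log_xFun_deriv ht.2)).sub
      (log_xFun_deriv (ht.2.trans h'))
    exact this.deriv
  rw [hE.deriv_eq]
  have := ((hasDerivAt_inv h0.ne').sub (log_xFun_deriv2 h)).sub (log_xFun_deriv2 (h.trans h'))
  refine Eq.trans this.deriv ?_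
  ring

theorem stmt11 (dc : ℝ → ℝ)
    (hdc : ∀ α ∈ Set.Ioo (0 : ℝ) 1, dc α ∈ Set.Ioo (0 : ℝ) α ∧
      deriv (deriv (fFun α)) (dc α) = 0) :
    ∃ C > (0 : ℝ), ∃ α₀ > (0 : ℝ), ∀ α ∈ Set.Ioo (0 : ℝ) α₀,
      |dc α - α / 2| ≤ C * α ^ 3 := by
  refine ⟨1, one_pos, 1 / 8, by norm_num, ?_⟩
  rintro α ⟨ha0, ha1⟩
  obtain ⟨⟨h0, h⟩, hz⟩ := hdc α ⟨ha0, by linarith⟩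
  generalize dc α = d at *
  have h' : α < 1 - α := by linarith
  rw [fFun_deriv2 h0 h h'] at hz
  have hx := xFun_pos h
  have hxe := xFun_eq h
  have hy := xFun_pos (h.trans h')
  have hye := xFun_eq (h.trans h')
  generalize xFun α d = x at *
  generalize xFun (1 - α) d = y at *
  have hy2 : 1 / 2 ≤ y := by nlinarith
  set Y := (4 * y + 1) / (y ^ 2 * (2 * y + 1) ^ 3) with hY
  have hY0 : 0 ≤ Y := by positivity
  have hY4 : Y ≤ 4 := by
    rw [hY, div_le_iff₀ (by positivity)]
    have a1 : 1 / 4 ≤ y ^ 2 := by nlinarith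
    have a2 : 4 * y + 1 ≤ (2 * y + 1) ^ 3 := by
      have : 0 < y ^ 3 := by positivity
      nlinarith
    have a3 : 0 < (2 * y + 1) ^ 3 := by positivity
    nlinarith
  set X := (3 + 4 * x) / ((1 + x) ^ 2 * (2 * x + 1) ^ 3) with hX
  have hX0 : 0 ≤ X := by positivity
  have hX3 : X ≤ 3 := by
    rw [hX, div_le_iff₀ (by positivity)]
    have a1 : 1 ≤ (1 + x) ^ 2 := by nlinarith
    have a2 : 1 + 6 * x ≤ (2 * x + 1) ^ 3 := by
      have : 0 < x ^ 3 := by positivity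
      nlinarith
    nlinarith
  have key : (4 * x + 1) / (x ^ 2 * (2 * x + 1) ^ 3) = 1 / (α - d) ^ 2 - X := by
    rw [← hxe, hX]
    have : x ^ 2 + x = x * (1 + x) := by ring
    rw [this]
    field_simp
    ring
  rw [key] at hz
  have hu : 0 < α - d := by linarith
  have e : (α - 2 * d) * α = (Y - X) * ((α - d) * d) ^ 2 := by
    generalize Y = Y at *
    generalize X = X at *
    field_simp at hz
    linear_combination -hz
  have b : ((α - d) * d) ^ 2 ≤ (α ^ 2 / 4) ^ 2 := by
    apply pow_le_pow_left₀ (by positivity)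
    nlinarith [sq_nonneg (α - 2 * d)]
  have b0 : 0 ≤ ((α - d) * d) ^ 2 := by positivity
  generalize ((α - d) * d) ^ 2 = Q at *
  have u1 : (α - 2 * d) * α ≤ α ^ 3 * α := by rw [e]; nlinarith
  have u2 : -(α ^ 3) * α ≤ (α - 2 * d) * α := by rw [e]; nlinarith
  have v1 := le_of_mul_le_mul_right u1 ha0
  have v2 := le_of_mul_le_mul_right u2 ha0
  have : 0 < α ^ 3 := by positivity
  rw [abs_le]
  constructor <;> linarith
end
end

section
/- Let d_c(α) ∈ (0,α) be the unique zero of f_α'', J_c(α) = f_α'(d_c(α)) and h_c(α) = f_α(d_c(α)) − J_c(α)·d_c(α). Then there exist constants C > 0 and α₀ > 0 such that |h_c(α) + 2 + log((√5−1)/2)| ≤ C·α for all α ∈ (0,α₀). -/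
noncomputable section
open Real Filter Topology

theorem aux_root (t : ℝ) (ht : 0 < t) :
    0 < (-1 + Real.sqrt (1 + 4 * t)) / 2 ∧
    ((-1 + Real.sqrt (1 + 4 * t)) / 2) ^ 2 + (-1 + Real.sqrt (1 + 4 * t)) / 2 = t := by
  have h1 : Real.sqrt (1 + 4 * t) ^ 2 = 1 + 4 * t := Real.sq_sqrt (by linarith)
  have h2 : 1 < Real.sqrt (1 + 4 * t) := by
    rw [Real.lt_sqrt (by norm_num)]; linarith
  constructor
  · linarith
  · nlinarith

theorem aux_deriv (c d : ℝ) (h : 0 < c - d) :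
    HasDerivAt (fun d => (-1 + Real.sqrt (1 + 4 * (c - d))) / 2)
      (-1 / (2 * ((-1 + Real.sqrt (1 + 4 * (c - d))) / 2) + 1)) d := by
  have h0 : (1 + 4 * (c - d)) ≠ 0 := by linarith
  have h1 : HasDerivAt (fun d => 1 + 4 * (c - d)) (-4) d := by
    have := (((hasDerivAt_id d).const_sub c).const_mul 4).const_add 1
    simpa using this
  have h2 := ((h1.sqrt h0).const_add (-1)).div_const 2
  have hs : 0 < Real.sqrt (1 + 4 * (c - d)) := Real.sqrt_pos.mpr (by linarith)
  refine h2.congr_deriv ?_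
  have : 2 * ((-1 + Real.sqrt (1 + 4 * (c - d))) / 2) + 1 = Real.sqrt (1 + 4 * (c - d)) := by ring
  rw [this]
  field_simp
  norm_num

theorem x_deriv (α d : ℝ) (h : 0 < α - d) :
    HasDerivAt (xFun α) (-1 / (2 * xFun α d + 1)) d := aux_deriv α d h

theorem y_deriv (α d : ℝ) (h : 0 < 1 - α - d) :
    HasDerivAt (yFun α) (-1 / (2 * yFun α d + 1)) d := aux_deriv (1 - α) d h

theorem f_deriv (α d : ℝ) (hd : 0 < d) (h : 0 < α - d) (h' : 0 < 1 - α - d) :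
    HasDerivAt (fFun α) (1 / d + 1 / (xFun α d * (2 * xFun α d + 1))
      + 1 / (yFun α d * (2 * yFun α d + 1))) d := by
  have hx : 0 < xFun α d := (aux_root _ h).1
  have hy : 0 < yFun α d := (aux_root _ h').1
  have := ((Real.hasDerivAt_log hd.ne').sub ((x_deriv α d h).log hx.ne')).sub
    ((y_deriv α d h').log hy.ne')
  refine this.congr_deriv ?_
  field_simp
  ring

theorem g_deriv (u : ℝ → ℝ) (d : ℝ) (hu : 0 < u d)
    (h : HasDerivAt u (-1 / (2 * u d + 1)) d) :
    HasDerivAt (fun d => 1 / (u d * (2 * u d + 1)))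
      ((4 * u d + 1) / (u d ^ 2 * (2 * u d + 1) ^ 3)) d := by
  have h1 := (h.mul ((h.const_mul 2).add_const 1)).fun_inv (by
    have : 0 < u d * (2 * u d + 1) := by positivity
    exact this.ne')
  simp only [one_div]
  refine h1.congr_deriv ?_
  simp only [Pi.mul_apply]
  field_simp
  ring

theorem f_deriv2 (α d : ℝ) (hd : 0 < d) (h : 0 < α - d) (h' : 0 < 1 - α - d) :
    deriv (deriv (fFun α)) d = -1 / d ^ 2
      + (4 * xFun α d + 1) / (xFun α d ^ 2 * (2 * xFun α d + 1) ^ 3)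
      + (4 * yFun α d + 1) / (yFun α d ^ 2 * (2 * yFun α d + 1) ^ 3) := by
  have hx : 0 < xFun α d := (aux_root _ h).1
  have hy : 0 < yFun α d := (aux_root _ h').1
  have e : deriv (fFun α) =ᶠ[𝓝 d] fun d => (1 / d + 1 / (xFun α d * (2 * xFun α d + 1))
      + 1 / (yFun α d * (2 * yFun α d + 1))) := by
    filter_upwards [lt_mem_nhds hd, gt_mem_nhds (show d < α by linarith),
      gt_mem_nhds (show d < 1 - α by linarith)] with z h1 h2 h3
    exact (f_deriv α z h1 (by linarith) (by linarith)).deriv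
  rw [e.deriv_eq]
  have h1 : HasDerivAt (fun d : ℝ => 1 / d) (-1 / d ^ 2) d := by
    simp only [one_div]
    exact (hasDerivAt_inv hd.ne').congr_deriv (by field_simp)
  exact ((h1.add (g_deriv _ d hx (x_deriv α d h))).add (g_deriv _ d hy (y_deriv α d h'))).deriv

theorem abs_log_bound (s e : ℝ) (hs : 1 / 2 ≤ s) (h : |s - 1| ≤ e) : |Real.log s| ≤ 2 * e := by
  have h0 : 0 < s := by linarith
  have h1 := Real.log_le_sub_one_of_pos h0
  have h2 := Real.one_sub_inv_le_log_of_pos h0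
  obtain ⟨ha, hb⟩ := abs_le.mp h
  have h3 : s⁻¹ - 1 ≤ 2 * e := by
    have : s⁻¹ - 1 = (1 - s) / s := by field_simp
    rw [this, div_le_iff₀ h0]
    nlinarith
  rw [abs_le]; constructor <;> linarith

set_option maxHeartbeats 1000000 in
theorem key (α d x y p : ℝ) (ha : α < 1 / 10) (hd : 0 < d) (hda : d < α)
    (hx : 0 < x) (hy : 0 < y) (hp : 0 < p) (ex : x ^ 2 + x = α - d) (ey : y ^ 2 + y = 1 - α - d)
    (ep : p ^ 2 + p = 1)
    (h : -1 / d ^ 2 + (4 * x + 1) / (x ^ 2 * (2 * x + 1) ^ 3)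
      + (4 * y + 1) / (y ^ 2 * (2 * y + 1) ^ 3) = 0) :
    |(Real.log d - Real.log x - Real.log y
      - (1 / d + 1 / (x * (2 * x + 1)) + 1 / (y * (2 * y + 1))) * d) + 2 + Real.log p|
      ≤ 20 * α := by
  have hxa : x ≤ α := by nlinarith
  have hy2 : 1 / 2 ≤ y := by nlinarith
  have hy1 : y ≤ 1 := by nlinarith
  have hp2 : 1 / 2 ≤ p := by nlinarith
  have hpy : p - y ≤ 2 * α := by nlinarith
  have hpy' : y ≤ p := by nlinarith
  -- Y bound
  obtain ⟨Y, hY⟩ : ∃ Y, Y = (4 * y + 1) / (y ^ 2 * (2 * y + 1) ^ 3) := ⟨_, rfl⟩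
  have hY0 : 0 < Y := by rw [hY]; positivity
  have hY1 : Y ≤ 5 / 2 := by
    rw [hY, div_le_iff₀ (by positivity)]
    have a1 : (1 / 2 : ℝ) ^ 2 ≤ y ^ 2 := by gcongr
    have a2 : (2 : ℝ) ^ 3 ≤ (2 * y + 1) ^ 3 := by gcongr; linarith
    have : (1 / 2 : ℝ) ^ 2 * 2 ^ 3 ≤ y ^ 2 * (2 * y + 1) ^ 3 := by gcongr
    linarith
  rw [← hY] at h
  obtain ⟨R, hR⟩ : ∃ R, R = (4 * x + 1) / (2 * x + 1) ^ 3 := ⟨_, rfl⟩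
  have hR1 : R ≤ 1 := by
    rw [hR, div_le_one (by positivity)]
    nlinarith [pow_pos hx 2, pow_pos hx 3]
  have hR0 : 1 - 2 * x ≤ R := by
    rw [hR, le_div_iff₀ (by positivity)]
    nlinarith [pow_pos hx 4, pow_pos hx 3]
  obtain ⟨s, hs⟩ : ∃ s, s = x / d := ⟨_, rfl⟩
  have hs0 : 0 < s := by rw [hs]; positivity
  have hq : s ^ 2 = R + Y * x ^ 2 := by
    have e1 : (4 * x + 1) / (x ^ 2 * (2 * x + 1) ^ 3) = R / x ^ 2 := by
      rw [hR]; field_simp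
    rw [e1] at h
    rw [hs]
    have e2 : (x / d) ^ 2 = x ^ 2 * (1 / d ^ 2) := by ring
    have e3 : 1 / d ^ 2 = R / x ^ 2 + Y := by
      have e4 : -1 / d ^ 2 = -(1 / d ^ 2) := by ring
      linarith
    rw [e2, e3]
    field_simp
  have hYx : Y * x ^ 2 ≤ x := by
    have h1 : Y * x ≤ 5 / 2 * (1 / 10) := by gcongr; linarith
    have h2 : Y * x * x ≤ 1 * x := by gcongr; linarith
    linarith
  have hYx0 : 0 ≤ Y * x ^ 2 := by positivity
  have hsl : |s - 1| ≤ 2 * x := by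
    have hk : (s - 1) * (s + 1) = s ^ 2 - 1 := by ring
    rw [abs_le]; constructor
    · by_contra hc
      push Not at hc
      have : (s - 1) * (s + 1) ≤ (s - 1) * 1 :=
        mul_le_mul_of_nonpos_left (by linarith) (by linarith)
      linarith
    · by_contra hc
      push Not at hc
      have : (s - 1) * 1 ≤ (s - 1) * (s + 1) :=
        mul_le_mul_of_nonneg_left (by linarith) (by linarith)
      linarith
  have hls := abs_log_bound s (2 * x) (by linarith [(abs_le.mp hsl).1]) hsl
  have hlog : Real.log s = Real.log x - Real.log d := by
    rw [hs, Real.log_div hx.ne' hd.ne']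
  have hlp : |Real.log (p / y)| ≤ 2 * (4 * α) := by
    have : p / y = 1 + (p - y) / y := by field_simp; ring
    have b0 : 0 ≤ (p - y) / y := div_nonneg (by linarith) hy.le
    have b1 : (p - y) / y ≤ 4 * α := by 
      rw [div_le_iff₀ hy]
      have : 4 * α * (1 / 2) ≤ 4 * α * y := mul_le_mul_of_nonneg_left hy2 (by linarith)
      linarith
    apply abs_log_bound
    · linarith
    · rw [this, abs_le]; constructor <;> linarith
  rw [Real.log_div hp.ne' hy.ne'] at hlp
  have hB0 : 0 ≤ d / (y * (2 * y + 1)) := by positivity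
  have hB1 : d / (y * (2 * y + 1)) ≤ α := by
    rw [div_le_iff₀ (by positivity)]
    have h1 : 1 / 2 * 2 ≤ y * (2 * y + 1) := by gcongr; linarith
    have h2 : α * 1 ≤ α * (y * (2 * y + 1)) :=
      mul_le_mul_of_nonneg_left (by linarith) (by linarith)
    linarith
  obtain ⟨A, hA⟩ : ∃ A, A = 1 / (s * (2 * x + 1)) := ⟨_, rfl⟩
  obtain ⟨hs1, hs2⟩ := abs_le.mp hsl
  have hA1 : A ≤ 1 + 5 * x := by
    rw [hA, div_le_iff₀ (by positivity)]
    have hxx : x * x ≤ 1 / 10 * x := by gcongr; linarith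
    have h1 : (1 - 2 * x) * (2 * x + 1) ≤ s * (2 * x + 1) := by gcongr; linarith
    have h2 : (1 + 5 * x) * (1 - x) ≤ (1 + 5 * x) * (s * (2 * x + 1)) :=
      mul_le_mul_of_nonneg_left (by linarith) (by linarith)
    linarith
  have hA0 : 1 - 5 * x ≤ A := by
    rw [hA, le_div_iff₀ (by positivity)]
    have : s * (2 * x + 1) ≤ (1 + 2 * x) * (2 * x + 1) := by gcongr; linarith
    have h2 : (1 - 5 * x) * (s * (2 * x + 1)) ≤ (1 - 5 * x) * ((1 + 2 * x) * (2 * x + 1)) :=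
      mul_le_mul_of_nonneg_left this (by linarith)
    have h3 : 0 < x ^ 3 := by positivity
    have h4 : 0 < x ^ 2 := by positivity
    linarith
  have hE : (1 / d + 1 / (x * (2 * x + 1)) + 1 / (y * (2 * y + 1))) * d
      = 1 + A + d / (y * (2 * y + 1)) := by
    rw [hA, hs]; field_simp
  rw [hE]
  obtain ⟨l1, l2⟩ := abs_le.mp hls
  obtain ⟨l3, l4⟩ := abs_le.mp hlp
  rw [abs_le]
  constructor <;> linarith

theorem stmt13 (dc : ℝ → ℝ)
    (hdc : ∀ α ∈ Set.Ioo (0 : ℝ) 1, dc α ∈ Set.Ioo (0 : ℝ) α ∧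
      deriv (deriv (fFun α)) (dc α) = 0) :
    ∃ C > (0 : ℝ), ∃ α₀ > (0 : ℝ), ∀ α ∈ Set.Ioo (0 : ℝ) α₀,
      |(fFun α (dc α) - deriv (fFun α) (dc α) * dc α) + 2 +
          Real.log ((Real.sqrt 5 - 1) / 2)| ≤ C * α := by
  refine ⟨20, by norm_num, 1 / 10, by norm_num, ?_⟩
  rintro α ⟨h0, h1⟩
  obtain ⟨⟨hd, hda⟩, h2⟩ := hdc α ⟨h0, by linarith⟩
  have hx : 0 < α - dc α := by linarith
  have hy : 0 < 1 - α - dc α := by linarith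
  rw [f_deriv2 α _ hd hx hy] at h2
  rw [(f_deriv α _ hd hx hy).deriv]
  have hp := aux_root 1 one_pos
  have e : (-1 + Real.sqrt (1 + 4 * 1)) / 2 = (Real.sqrt 5 - 1) / 2 := by
    norm_num; ring
  rw [e] at hp
  exact key α (dc α) (xFun α (dc α)) (yFun α (dc α)) _ h1 hd hda (aux_root _ hx).1
    (aux_root _ hy).1 hp.1 (aux_root _ hx).2 (aux_root _ hy).2 hp.2 h2
end
end

section
/- Let J = 0 and suppose the 2×2 matrix W = [[e^{h_A}, e^{h_AB}], [e^{h_AB}, e^{h_B}]] is positive definite. Then the partition function admits the Gaussian representation Z_N = E[(1+ξ_A)^{N_A}·(1+ξ_B)^{N_B}], where ξ = (ξ_A, ξ_B) is a centred Gaussian vector in ℝ² with covariance matrix W/N; equivalently, Σ_{Δ} (w_A/N)^{D_A}·(w_B/N)^{D_B}·(w_AB/N)^{D_AB} = E[(1+ξ_A)^{N_A}(1+ξ_B)^{N_B}] with w_A = e^{h_A}, w_B = e^{h_B}, w_AB = e^{h_AB}. -/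
noncomputable section
open Real Matrix MeasureTheory

/-- Partition function at J = 0, with dimer activities w_A = e^{h_A}, w_B = e^{h_B},
w_AB = e^{h_AB}. -/
def mdZ0 (N NA : ℕ) (hA hB hAB : ℝ) : ℝ :=
  ∑ Δ ∈ mdConfigs N,
    (Real.exp hA / N) ^ countA N NA Δ * (Real.exp hB / N) ^ countB N NA Δ *
      (Real.exp hAB / N) ^ countAB N NA Δ

/-- The covariance matrix W. -/
def covW (hA hB hAB : ℝ) : Matrix (Fin 2) (Fin 2) ℝ :=
  !![Real.exp hA, Real.exp hAB; Real.exp hAB, Real.exp hB]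

/-- Density of a centred Gaussian vector on ℝ² with covariance matrix `S`. -/
def gaussDensity (S : Matrix (Fin 2) (Fin 2) ℝ) (x : Fin 2 → ℝ) : ℝ :=
  (2 * Real.pi)⁻¹ * (Real.sqrt S.det)⁻¹ *
    Real.exp (-(1 / 2) * (S⁻¹.mulVec x ⬝ᵥ x))

section Analytic
open ProbabilityTheory
open scoped NNReal

def gm (v : ℝ≥0) (n : ℕ) : ℝ := ∫ x : ℝ, x ^ n * gaussianPDFReal 0 v x

lemma gm_integrable {v : ℝ≥0} (hv : v ≠ 0) (n : ℕ) :
    Integrable (fun x : ℝ => x ^ n * gaussianPDFReal 0 v x) := by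
  have h : 0 < (2 * (v : ℝ))⁻¹ := by positivity
  have := (integrable_rpow_mul_exp_neg_mul_sq h (s := n)
    (by have : (0:ℝ) ≤ n := Nat.cast_nonneg n
        linarith)).const_mul ((√(2 * π * v))⁻¹)
  refine this.congr (Filter.Eventually.of_forall fun x => ?_)
  simp only [gaussianPDFReal, Real.rpow_natCast, sub_zero]
  have : -(2 * (v:ℝ))⁻¹ * x ^ 2 = -x ^ 2 / (2 * v) := by ring
  rw [this]; ring

lemma gm_zero {v : ℝ≥0} (hv : v ≠ 0) : gm v 0 = 1 := by
  simp [gm, integral_gaussianPDFReal_eq_one 0 hv]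

lemma gaussPDF_hasDeriv {v : ℝ≥0} (hv : v ≠ 0) (x : ℝ) :
    HasDerivAt (gaussianPDFReal 0 v) (-(x / v) * gaussianPDFReal 0 v x) x := by
  have hv' : (v : ℝ) ≠ 0 := by exact_mod_cast hv
  have h1 : HasDerivAt (fun x : ℝ => -(x - 0) ^ 2 / (2 * (v:ℝ))) (-(x / v)) x := by
    have := ((((hasDerivAt_id x).sub_const 0).pow 2).neg).div_const (2 * (v:ℝ))
    refine this.congr_deriv ?_
    simp only [id]
    field_simp
    norm_num
    ring
  have := (h1.exp).const_mul ((√(2 * π * v))⁻¹)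
  refine this.congr_deriv ?_
  simp only [gaussianPDFReal]; ring

lemma gm_succ {v : ℝ≥0} (hv : v ≠ 0) (n : ℕ) : gm v (n + 1) = v * (n * gm v (n - 1)) := by
  have hv' : (v : ℝ) ≠ 0 := by exact_mod_cast hv
  have hd : ∀ x : ℝ, HasDerivAt (fun x => x ^ n * gaussianPDFReal 0 v x)
      (n * (x ^ (n - 1) * gaussianPDFReal 0 v x)
        - (v:ℝ)⁻¹ * (x ^ (n+1) * gaussianPDFReal 0 v x)) x := by
    intro x
    have := (hasDerivAt_pow n x).mul (gaussPDF_hasDeriv hv x)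
    refine this.congr_deriv ?_
    field_simp; ring
  have i1 := (gm_integrable hv (n-1)).const_mul (n:ℝ)
  have i2 := (gm_integrable hv (n+1)).const_mul ((v:ℝ)⁻¹)
  have := integral_eq_zero_of_hasDerivAt_of_integrable hd (i1.sub i2) (gm_integrable hv n)
  rw [integral_sub i1 i2, integral_const_mul, integral_const_mul] at this
  change n * gm v (n-1) - (v:ℝ)⁻¹ * gm v (n+1) = 0 at this
  field_simp at this
  linarith

open MvPolynomial

def LI (a d : ℝ≥0) (p : MvPolynomial (Fin 2) ℝ) (z : ℝ × ℝ) : ℝ :=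
  MvPolynomial.eval ![z.1, z.2] p * (gaussianPDFReal 0 a z.1 * gaussianPDFReal 0 d z.2)

def LL (a d : ℝ≥0) (p : MvPolynomial (Fin 2) ℝ) : ℝ := ∫ z : ℝ × ℝ, LI a d p z

variable {a d : ℝ≥0}

lemma LI_mono (s : Fin 2 →₀ ℕ) (r : ℝ) : LI a d (monomial s r) = fun z : ℝ × ℝ =>
    r * ((z.1 ^ (s 0) * gaussianPDFReal 0 a z.1) * (z.2 ^ (s 1) * gaussianPDFReal 0 d z.2)) := by
  funext z
  simp only [LI, eval_monomial]
  rw [Finsupp.prod_fintype _ _ (by simp), Fin.prod_univ_two]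
  simp; ring

lemma LL_mono (s : Fin 2 →₀ ℕ) (r : ℝ) :
    LL a d (monomial s r) = r * (gm a (s 0) * gm d (s 1)) := by
  rw [LL, LI_mono, integral_const_mul]
  congr 1
  rw [Measure.volume_eq_prod]
  exact integral_prod_mul (fun x : ℝ => x ^ (s 0) * gaussianPDFReal 0 a x)
    (fun y : ℝ => y ^ (s 1) * gaussianPDFReal 0 d y)

lemma LI_add (p q : MvPolynomial (Fin 2) ℝ) : LI a d (p + q) = LI a d p + LI a d q := by
  funext z; simp [LI, add_mul]

lemma LI_integrable (ha : a ≠ 0) (hd : d ≠ 0) (p : MvPolynomial (Fin 2) ℝ) :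
    Integrable (LI a d p) := by
  induction p using MvPolynomial.induction_on' with
  | monomial s r =>
    rw [LI_mono, Measure.volume_eq_prod]
    exact ((gm_integrable ha (s 0)).mul_prod (gm_integrable hd (s 1))).const_mul r
  | add p q hp hq => rw [LI_add]; exact hp.add hq

lemma LL_add (ha : a ≠ 0) (hd : d ≠ 0) (p q : MvPolynomial (Fin 2) ℝ) :
    LL a d (p + q) = LL a d p + LL a d q := by
  simp only [LL, LI_add]
  exact integral_add (LI_integrable ha hd p) (LI_integrable ha hd q)

lemma LL_C_mul (r : ℝ) (p : MvPolynomial (Fin 2) ℝ) :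
    LL a d (C r * p) = r * LL a d p := by
  simp only [LL, LI]
  rw [← integral_const_mul]
  congr 1; funext z; simp; ring

lemma LL_stein0 (ha : a ≠ 0) (hd : d ≠ 0) (p : MvPolynomial (Fin 2) ℝ) :
    LL a d (X 0 * p) = a * LL a d (pderiv 0 p) := by
  induction p using MvPolynomial.induction_on' with
  | monomial s r =>
    rw [mul_comm, X, monomial_mul, pderiv_monomial, LL_mono, LL_mono]
    simp [gm_succ ha]; ring
  | add p q hp hq => rw [mul_add, LL_add ha hd, hp, hq, map_add, LL_add ha hd]; ring

lemma LL_stein1 (ha : a ≠ 0) (hd : d ≠ 0) (p : MvPolynomial (Fin 2) ℝ) :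
    LL a d (X 1 * p) = d * LL a d (pderiv 1 p) := by
  induction p using MvPolynomial.induction_on' with
  | monomial s r =>
    rw [mul_comm, X, monomial_mul, pderiv_monomial, LL_mono, LL_mono]
    simp [gm_succ hd]; ring
  | add p q hp hq => rw [mul_add, LL_add ha hd, hp, hq, map_add, LL_add ha hd]; ring

def PP (k : ℝ) (m n : ℕ) : MvPolynomial (Fin 2) ℝ :=
  (1 + X 0) ^ m * (1 + (X 1 + C k * X 0)) ^ n

def MM (a d : ℝ≥0) (k : ℝ) (m n : ℕ) : ℝ := LL a d (PP k m n)

lemma MM_zero (ha : a ≠ 0) (hd : d ≠ 0) (k : ℝ) : MM a d k 0 0 = 1 := by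
  have : PP k 0 0 = monomial 0 1 := by simp [PP]
  rw [MM, this, LL_mono]; simp [gm_zero ha, gm_zero hd]

lemma pd0 (k : ℝ) (m n : ℕ) :
    pderiv 0 (PP k m n) = C (m:ℝ) * PP k (m-1) n + C (n * k) * PP k m (n-1) := by
  simp only [PP, pderiv_mul, pderiv_pow, map_add, pderiv_one, pderiv_X_self]
  rw [pderiv_X_of_ne (by decide)]
  simp; ring

lemma pd1 (k : ℝ) (m n : ℕ) :
    pderiv 1 (PP k m n) = C (n:ℝ) * PP k m (n-1) := by
  simp only [PP, pderiv_mul, pderiv_pow, map_add, pderiv_one, pderiv_X_self]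
  rw [pderiv_X_of_ne (by decide)]
  simp; ring

lemma MM_succ0 (ha : a ≠ 0) (hd : d ≠ 0) (k : ℝ) (m n : ℕ) :
    MM a d k (m+1) n = MM a d k m n + m * a * MM a d k (m-1) n
      + n * (a * k) * MM a d k m (n-1) := by
  have : PP k (m+1) n = PP k m n + X 0 * PP k m n := by simp [PP]; ring
  rw [MM, this, LL_add ha hd, LL_stein0 ha hd, pd0, LL_add ha hd, LL_C_mul, LL_C_mul]
  simp only [MM]; ring

lemma MM_succ1 (ha : a ≠ 0) (hd : d ≠ 0) (k : ℝ) (m n : ℕ) :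
    MM a d k m (n+1) = MM a d k m n + m * (a * k) * MM a d k (m-1) n
      + n * (d + a * k ^ 2) * MM a d k m (n-1) := by
  have : PP k m (n+1) = PP k m n + (X 1 * PP k m n + C k * (X 0 * PP k m n)) := by
    simp [PP]; ring
  rw [MM, this, LL_add ha hd, LL_add ha hd, LL_C_mul, LL_stein0 ha hd, LL_stein1 ha hd, pd0, pd1,
    LL_add ha hd, LL_C_mul, LL_C_mul, LL_C_mul]
  simp only [MM]; ring

lemma gauss_eq_MM (S : Matrix (Fin 2) (Fin 2) ℝ) (b c : ℝ) (k : ℝ) (ha : a ≠ 0) (hd : d ≠ 0)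
    (hS : S = !![(a:ℝ), c; c, b]) (hc : a * k = c) (hb : d + a * k ^ 2 = b) (m n : ℕ) :
    ∫ x : Fin 2 → ℝ, (1 + x 0) ^ m * (1 + x 1) ^ n * gaussDensity S x = MM a d k m n := by
  have ha' : (a : ℝ) ≠ 0 := by exact_mod_cast ha
  have hd' : (d : ℝ) ≠ 0 := by exact_mod_cast hd
  have hdet : S.det = a * d := by
    rw [hS, Matrix.det_fin_two_of, ← hb, ← hc]; ring
  have hinv : S⁻¹ = (a * d : ℝ)⁻¹ • !![b, -c; -c, (a:ℝ)] := by
    rw [Matrix.inv_def, hdet, hS, Matrix.adjugate_fin_two_of]; simp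
  have hskew : MeasurePreserving (fun p : ℝ × ℝ => (p.1, p.2 + k * p.1))
      (volume : Measure (ℝ × ℝ)) volume := by
    rw [Measure.volume_eq_prod]
    exact (MeasurePreserving.id volume).skew_product (g := fun x y => y + k * x)
      (by unfold Function.uncurry; fun_prop)
      (Filter.Eventually.of_forall fun x => map_add_right_eq_self volume (k * x))
  have hemb : MeasurableEmbedding (fun p : ℝ × ℝ => (p.1, p.2 + k * p.1)) := by
    apply Measurable.measurableEmbedding (by fun_prop)
    rintro ⟨x, y⟩ ⟨x', y'⟩ h
    simp only [Prod.mk.injEq] at h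
    obtain ⟨h1, h2⟩ := h
    subst h1
    simp at h2
    simp [h2]
  rw [← (volume_preserving_finTwoArrow ℝ).symm.integral_comp
    (MeasurableEquiv.measurableEmbedding _), ← hskew.integral_comp hemb, MM, LL]
  congr 1
  funext z
  obtain ⟨x, y⟩ := z
  simp only [LI, PP, gaussDensity, gaussianPDFReal, hdet, hinv]
  have hs : (√(2 * π * a))⁻¹ * (√(2 * π * d))⁻¹ = (2 * π)⁻¹ * (√(a * d : ℝ))⁻¹ := by
    rw [← mul_inv, ← mul_inv, ← Real.sqrt_mul (by positivity)]
    congr 1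
    rw [show 2 * π * (a:ℝ) * (2 * π * d) = (2 * π) ^ 2 * (a * d) by ring,
      Real.sqrt_mul (by positivity), Real.sqrt_sq (by positivity)]
  have he : ∀ x y : ℝ, -(1/2) * ((((a * d : ℝ)⁻¹ • !![b, -c; -c, (a:ℝ)]) *ᵥ ![x, y + k * x])
      ⬝ᵥ ![x, y + k * x]) = -(x - 0) ^ 2 / (2 * a) + -(y - 0)^2 / (2 * d) := by
    intro x y
    simp only [Matrix.smul_mulVec, smul_dotProduct, Matrix.cons_mulVec, Matrix.empty_mulVec,
      Matrix.dotProduct_cons, smul_eq_mul]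
    simp [← hb, ← hc]
    field_simp
    ring
  have hx : (MeasurableEquiv.finTwoArrow (α := ℝ)).symm (x, y + k * x) = ![x, y + k * x] := rfl
  rw [hx, he, Real.exp_add, ← hs]
  simp only [map_mul, map_pow, map_add, map_one, eval_X, eval_C, Matrix.cons_val_zero,
    Matrix.cons_val_one]
  ring
end Analytic

section Comb
open scoped Classical

def CC (N : ℕ) (S : Finset (Fin N)) : Finset (Finset (Sym2 (Fin N))) :=
  Finset.univ.filter fun Δ => IsMDConfig N Δ ∧ ∀ e ∈ Δ, ∀ v ∈ e, v ∈ S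

def ZZ (N : ℕ) (w : Sym2 (Fin N) → ℝ) (S : Finset (Fin N)) : ℝ :=
  ∑ Δ ∈ CC N S, ∏ e ∈ Δ, w e

lemma mem_CC {N : ℕ} {S : Finset (Fin N)} {Δ : Finset (Sym2 (Fin N))} :
    Δ ∈ CC N S ↔ IsMDConfig N Δ ∧ ∀ e ∈ Δ, ∀ v ∈ e, v ∈ S := by simp [CC]

lemma ZZ_empty (N : ℕ) (w : Sym2 (Fin N) → ℝ) : ZZ N w ∅ = 1 := by
  have : CC N ∅ = {∅} := by
    ext Δ
    rw [mem_CC, Finset.mem_singleton]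
    constructor
    · rintro ⟨-, h⟩
      refine Finset.eq_empty_of_forall_notMem fun e he => ?_
      have := h e he e.out.1 (Sym2.out_fst_mem e)
      simp at this
    · rintro rfl; simp [IsMDConfig]
  simp [ZZ, this]

lemma ZZ_insert (N : ℕ) (w : Sym2 (Fin N) → ℝ) (S : Finset (Fin N)) (v : Fin N) (hv : v ∉ S) :
    ZZ N w (insert v S) = ZZ N w S + ∑ u ∈ S, w s(v, u) * ZZ N w (S.erase u) := by
  have hsub : (CC N (insert v S)).filter (fun Δ => ∀ e ∈ Δ, v ∉ e) = CC N S := by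
    ext Δ
    simp only [Finset.mem_filter, mem_CC]
    constructor
    · rintro ⟨⟨h1, h2⟩, h3⟩
      refine ⟨h1, fun e he u hu => ?_⟩
      rcases Finset.mem_insert.1 (h2 e he u hu) with rfl | h
      · exact absurd hu (h3 e he)
      · exact h
    · rintro ⟨h1, h2⟩
      exact ⟨⟨h1, fun e he u hu => Finset.mem_insert_of_mem (h2 e he u hu)⟩,
        fun e he hve => hv (h2 e he v hve)⟩
  rw [ZZ, ← Finset.sum_filter_add_sum_filter_not _ (fun Δ => ∀ e ∈ Δ, v ∉ e), hsub]
  congr 1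
  simp only [ZZ, Finset.mul_sum]
  rw [Finset.sum_sigma']
  symm
  have key : ∀ u ∈ S, ∀ Δ ∈ CC N (S.erase u), ∀ e ∈ Δ, v ∉ e ∧ u ∉ e := by
    intro u _ Δ hΔ e he
    rw [mem_CC] at hΔ
    refine ⟨fun h => hv (Finset.mem_of_mem_erase (hΔ.2 e he v h)), fun h => ?_⟩
    exact Finset.notMem_erase u S (hΔ.2 e he u h)
  have hnot : ∀ u ∈ S, ∀ Δ ∈ CC N (S.erase u), ∀ u' : Fin N, s(v, u') ∉ Δ := by
    intro u hu Δ hΔ u' h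
    exact (key u hu Δ hΔ _ h).1 (Sym2.mem_mk_left v u')
  refine Finset.sum_bij (fun (q : (_ : Fin N) × Finset (Sym2 (Fin N))) _ =>
    insert s(v, q.1) q.2) ?_ ?_ ?_ ?_
  · rintro ⟨u, Δ⟩ hq
    obtain ⟨hu, hΔ⟩ := Finset.mem_sigma.1 hq
    simp only at hu hΔ
    have hk := key u hu Δ hΔ
    have huv : v ≠ u := fun h => hv (h ▸ hu)
    have hΔ' := mem_CC.1 hΔ
    simp only [Finset.mem_filter, mem_CC]
    refine ⟨⟨⟨?_, ?_⟩, ?_⟩, ?_⟩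
    · intro e he
      rcases Finset.mem_insert.1 he with rfl | he
      · simpa using huv
      · exact hΔ'.1.1 e he
    · intro e he e' he' hne x hx hx'
      rcases Finset.mem_insert.1 he with rfl | he1 <;>
        rcases Finset.mem_insert.1 he' with rfl | he2
      · exact hne rfl
      · rcases Sym2.mem_iff.1 hx with rfl | rfl
        · exact (hk e' he2).1 hx'
        · exact (hk e' he2).2 hx'
      · rcases Sym2.mem_iff.1 hx' with rfl | rfl
        · exact (hk e he1).1 hx
        · exact (hk e he1).2 hx
      · exact hΔ'.1.2 e he1 e' he2 hne x hx hx'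
    · intro e he x hx
      rcases Finset.mem_insert.1 he with rfl | he
      · rcases Sym2.mem_iff.1 hx with rfl | rfl
        · exact Finset.mem_insert_self _ _
        · exact Finset.mem_insert_of_mem hu
      · exact Finset.mem_insert_of_mem (Finset.mem_of_mem_erase (hΔ'.2 e he x hx))
    · intro h
      exact h _ (Finset.mem_insert_self _ _) (Sym2.mem_mk_left v u)
  · rintro ⟨u, Δ⟩ hq ⟨u', Δ'⟩ hq' heq
    obtain ⟨hu, hΔ⟩ := Finset.mem_sigma.1 hq
    obtain ⟨hu', hΔ'⟩ := Finset.mem_sigma.1 hq'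
    simp only at hu hΔ hu' hΔ' heq
    have h1 : s(v, u) ∈ insert s(v, u') Δ' := heq ▸ Finset.mem_insert_self _ _
    rcases Finset.mem_insert.1 h1 with h1 | h1
    · have : u = u' := Sym2.congr_right.1 h1
      subst this
      have : Δ = Δ' := by
        rw [← Finset.erase_insert (hnot u hu Δ hΔ u), heq,
          Finset.erase_insert (hnot u hu Δ' hΔ' u)]
      rw [this]
    · exact absurd h1 (hnot u' hu' Δ' hΔ' u)
  · intro Δ hΔ
    simp only [Finset.mem_filter, mem_CC, not_forall, not_not] at hΔ
    obtain ⟨⟨hc, hs⟩, e, he, hve⟩ := hΔ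
    obtain ⟨u, rfl⟩ := Sym2.mem_iff_exists.1 hve
    have huv : v ≠ u := by simpa using hc.1 _ he
    have hu : u ∈ S := by
      rcases Finset.mem_insert.1 (hs _ he u (Sym2.mem_mk_right v u)) with h | h
      · exact absurd h.symm huv
      · exact h
    refine ⟨⟨u, Δ.erase s(v, u)⟩, ?_, Finset.insert_erase he⟩
    refine Finset.mem_sigma.2 ⟨hu, mem_CC.2 ⟨⟨?_, ?_⟩, ?_⟩⟩
    · exact fun e' he' => hc.1 e' (Finset.mem_of_mem_erase he')
    · exact fun e' he' e'' he'' => hc.2 e' (Finset.mem_of_mem_erase he') e''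
        (Finset.mem_of_mem_erase he'')
    · intro e' he' x hx
      obtain ⟨hne, he'⟩ := Finset.mem_erase.1 he'
      have hdis := hc.2 e' he' _ he hne x hx
      rw [Sym2.mem_iff, not_or] at hdis
      refine Finset.mem_erase.2 ⟨hdis.2, ?_⟩
      exact (Finset.mem_insert.1 (hs e' he' x hx)).resolve_left hdis.1
  · rintro ⟨u, Δ⟩ hq
    obtain ⟨hu, hΔ⟩ := Finset.mem_sigma.1 hq
    simp only at hu hΔ ⊢
    rw [Finset.prod_insert (hnot u hu Δ hΔ u)]

def ww (N NA : ℕ) (a b c : ℝ) (e : Sym2 (Fin N)) : ℝ :=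
  (if ∀ v : Fin N, v ∈ e → (v : ℕ) < NA then a else 1) *
  (if ∀ v : Fin N, v ∈ e → NA ≤ (v : ℕ) then b else 1) *
  (if (∃ v : Fin N, v ∈ e ∧ (v : ℕ) < NA) ∧ ∃ v : Fin N, v ∈ e ∧ NA ≤ (v : ℕ) then c else 1)

lemma ww_mk (N NA : ℕ) (a b c : ℝ) (u v : Fin N) : ww N NA a b c s(u, v) =
    if (u : ℕ) < NA then (if (v : ℕ) < NA then a else c)
    else (if (v : ℕ) < NA then c else b) := by
  by_cases hu : (u : ℕ) < NA <;> by_cases hv : (v : ℕ) < NA <;>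
    simp [ww, hu, hv, or_and_right, exists_or, not_le.2, not_lt.1]

lemma prod_ww (N NA : ℕ) (a b c : ℝ) (Δ : Finset (Sym2 (Fin N))) :
    ∏ e ∈ Δ, ww N NA a b c e = a ^ countA N NA Δ * b ^ countB N NA Δ * c ^ countAB N NA Δ := by
  simp only [ww, Finset.prod_mul_distrib, countA, countB, countAB, Finset.prod_ite,
    Finset.prod_const, one_pow, mul_one]

def nA (N NA : ℕ) (S : Finset (Fin N)) : ℕ := (S.filter fun v : Fin N => (v : ℕ) < NA).card
def nB (N NA : ℕ) (S : Finset (Fin N)) : ℕ := (S.filter fun v : Fin N => ¬ (v : ℕ) < NA).card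

lemma ZZ_eq (N NA : ℕ) (a b c : ℝ) (M : ℕ → ℕ → ℝ) (h0 : M 0 0 = 1)
    (hA : ∀ m n, M (m+1) n = M m n + m * a * M (m-1) n + n * c * M m (n-1))
    (hB : ∀ m n, M m (n+1) = M m n + m * c * M (m-1) n + n * b * M m (n-1))
    (r : ℕ) : ∀ S : Finset (Fin N), S.card = r →
      ZZ N (ww N NA a b c) S = M (nA N NA S) (nB N NA S) := by
  induction r using Nat.strong_induction_on with
  | _ r ih =>
  intro S hS
  rcases S.eq_empty_or_nonempty with rfl | ⟨v, hv⟩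
  · rw [ZZ_empty]; simp [nA, nB, h0]
  obtain ⟨T, hvT, rfl⟩ : ∃ T, v ∉ T ∧ insert v T = S :=
    ⟨S.erase v, Finset.notMem_erase v S, Finset.insert_erase hv⟩
  rw [Finset.card_insert_of_notMem hvT] at hS
  rw [ZZ_insert _ _ _ _ hvT, ih _ (by omega) T rfl]
  have hsum : ∑ u ∈ T, ww N NA a b c s(v, u) * ZZ N (ww N NA a b c) (T.erase u) =
      ∑ u ∈ T, if (u : ℕ) < NA
        then (if (v : ℕ) < NA then a else c) * M (nA N NA T - 1) (nB N NA T)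
        else (if (v : ℕ) < NA then c else b) * M (nA N NA T) (nB N NA T - 1) := by
    refine Finset.sum_congr rfl fun u hu => ?_
    rw [ih _ (by have := Finset.card_erase_lt_of_mem hu; omega) (T.erase u) rfl, ww_mk]
    by_cases h : (u : ℕ) < NA
    · have e1 : nA N NA (T.erase u) = nA N NA T - 1 := by
        rw [nA, Finset.filter_erase, Finset.card_erase_of_mem (by simp [hu, h]), nA]
      have e2 : nB N NA (T.erase u) = nB N NA T := by
        rw [nB, Finset.filter_erase, Finset.erase_eq_of_notMem (by simp [h]), nB]
      simp [h, e1, e2]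
    · have e1 : nA N NA (T.erase u) = nA N NA T := by
        rw [nA, Finset.filter_erase, Finset.erase_eq_of_notMem (by simp [h]), nA]
      have e2 : nB N NA (T.erase u) = nB N NA T - 1 := by
        rw [nB, Finset.filter_erase, Finset.card_erase_of_mem (by simp [hu, not_lt.1 h]), nB]
      simp [h, e1, e2]
  rw [hsum, Finset.sum_ite, Finset.sum_const, Finset.sum_const]
  change _ + (nA N NA T • _ + nB N NA T • _) = _
  by_cases h : (v : ℕ) < NA
  · have e1 : nA N NA (insert v T) = nA N NA T + 1 := by
      rw [nA, Finset.filter_insert, if_pos h, Finset.card_insert_of_notMem (by simp [hvT]), nA]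
    have e2 : nB N NA (insert v T) = nB N NA T := by
      rw [nB, Finset.filter_insert, if_neg (by simpa using h), nB]
    rw [e1, e2, hA]; simp only [h, if_true, nsmul_eq_mul]; ring
  · have e1 : nA N NA (insert v T) = nA N NA T := by
      rw [nA, Finset.filter_insert, if_neg h, nA]
    have e2 : nB N NA (insert v T) = nB N NA T + 1 := by
      rw [nB, Finset.filter_insert, if_pos h, Finset.card_insert_of_notMem (by simp [hvT]), nB]
    rw [e1, e2, hB]; simp only [h, if_false, nsmul_eq_mul]; ring

lemma nA_univ (NA NB : ℕ) : nA (NA + NB) NA Finset.univ = NA := by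
  rw [nA, ← Fintype.card_subtype, Fintype.card_fin_lt_of_le (by omega)]

lemma nB_univ (NA NB : ℕ) : nB (NA + NB) NA Finset.univ = NB := by
  have h := Finset.card_filter_add_card_filter_not (s := (Finset.univ : Finset (Fin (NA + NB))))
    (fun v : Fin (NA + NB) => (v : ℕ) < NA)
  have h1 := nA_univ NA NB
  simp only [nA, nB, Finset.card_univ, Fintype.card_fin] at *
  omega

lemma mdZ0_eq (N NA : ℕ) (hA hB hAB : ℝ) : mdZ0 N NA hA hB hAB =
    ZZ N (ww N NA (Real.exp hA / N) (Real.exp hB / N) (Real.exp hAB / N)) Finset.univ := by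
  have : CC N Finset.univ = mdConfigs N := by
    ext Δ; simp [mem_CC, mdConfigs]
  rw [ZZ, this, mdZ0]
  exact Finset.sum_congr rfl fun Δ _ => (prod_ww ..).symm
end Comb

theorem stmt15 (hA hB hAB : ℝ) (hW : (covW hA hB hAB).PosDef)
    (NA NB N : ℕ) (hN : N = NA + NB) (hNpos : 0 < N) :
    mdZ0 N NA hA hB hAB =
      ∫ x : Fin 2 → ℝ,
        (1 + x 0) ^ NA * (1 + x 1) ^ NB *
          gaussDensity ((N : ℝ)⁻¹ • covW hA hB hAB) x := by
  have hN0 : (0 : ℝ) < N := by exact_mod_cast hNpos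
  have hdet := hW.det_pos
  rw [covW, Matrix.det_fin_two_of] at hdet
  have hapos : 0 < Real.exp hA / N := by positivity
  have hdpos : 0 < Real.exp hB / N - Real.exp hA / N * (Real.exp hAB / Real.exp hA) ^ 2 := by
    have : Real.exp hB / N - Real.exp hA / N * (Real.exp hAB / Real.exp hA) ^ 2 =
        (Real.exp hA * Real.exp hB - Real.exp hAB * Real.exp hAB) / (N * Real.exp hA) := by
      have := (Real.exp_pos hA).ne'
      field_simp
    rw [this]; positivity
  obtain ⟨a, ha⟩ : ∃ a : NNReal, (a : ℝ) = Real.exp hA / N := ⟨⟨_, hapos.le⟩, rfl⟩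
  obtain ⟨d, hd⟩ : ∃ d : NNReal, (d : ℝ) =
      Real.exp hB / N - Real.exp hA / N * (Real.exp hAB / Real.exp hA) ^ 2 := ⟨⟨_, hdpos.le⟩, rfl⟩
  have ha0 : a ≠ 0 := by
    rintro rfl
    rw [← ha] at hapos
    simp at hapos
  have hd0 : d ≠ 0 := by
    rintro rfl
    rw [← hd] at hdpos
    simp at hdpos
  have hc : (a : ℝ) * (Real.exp hAB / Real.exp hA) = Real.exp hAB / N := by
    rw [ha]
    have := (Real.exp_pos hA).ne'
    field_simp
  have hb : (d : ℝ) + a * (Real.exp hAB / Real.exp hA) ^ 2 = Real.exp hB / N := by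
    rw [hd, ha]; ring
  rw [gauss_eq_MM _ (Real.exp hB / N) (Real.exp hAB / N) (Real.exp hAB / Real.exp hA) ha0 hd0
    ?_ hc hb, mdZ0_eq, ZZ_eq N NA _ _ _ (MM a d (Real.exp hAB / Real.exp hA))
      (MM_zero ha0 hd0 _) ?_ ?_ _ Finset.univ rfl]
  · subst hN
    rw [nA_univ, nB_univ]
  · intro m n
    rw [MM_succ0 ha0 hd0, hc, ha]
  · intro m n
    rw [MM_succ1 ha0 hd0, hc, hb]
  · rw [covW, ha]
    ext i j
    fin_cases i <;> fin_cases j <;> simp <;> ring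
end
end
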